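/- Let S be an even negative definite lattice admitting a primitive embedding into the lattice U³ ⊕ E8(−1)² ⊕ (−2). Then there exists an even negative definite unimodular lattice N of rank 24 (a Niemeier lattice) together with a primitive embedding of S into N. -/

import Mathlib

open Matrix

/-!
Every even negative definite lattice that embeds primitively into
`L = U³ ⊕ E8(-1)² ⊕ (-2)` also embeds primitively into some Niemeier lattice,
i.e. an even negative definite unimodular lattice of rank 24.
-/

/-- The hyperbolic plane `U`. -/
def UMat : Matrix (Fin 2) (Fin 2) ℤ := !![0, 1; 1, 0]

/-- `E8(-1)`: the negative of the Cartan matrix of `E8` (Bourbaki numbering). -/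
def E8N : Matrix (Fin 8) (Fin 8) ℤ :=
  !![-2,  0,  1,  0,  0,  0,  0,  0;
      0, -2,  0,  1,  0,  0,  0,  0;
      1,  0, -2,  1,  0,  0,  0,  0;
      0,  1,  1, -2,  1,  0,  0,  0;
      0,  0,  0,  1, -2,  1,  0,  0;
      0,  0,  0,  0,  1, -2,  1,  0;
      0,  0,  0,  0,  0,  1, -2,  1;
      0,  0,  0,  0,  0,  0,  1, -2]

/-- The rank 1 lattice `(-2)`. -/
def minusTwo : Matrix (Fin 1) (Fin 1) ℤ := !![-2]

/-- Index type for `L = U³ ⊕ E8(-1)² ⊕ (-2)` (rank 23). -/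
abbrev IdxL : Type := Fin 2 ⊕ (Fin 2 ⊕ (Fin 2 ⊕ (Fin 8 ⊕ (Fin 8 ⊕ Fin 1))))

/-- Gram matrix of `L = U³ ⊕ E8(-1)² ⊕ (-2)`. -/
def BL : Matrix IdxL IdxL ℤ :=
  Matrix.fromBlocks UMat 0 0 (Matrix.fromBlocks UMat 0 0
    (Matrix.fromBlocks UMat 0 0 (Matrix.fromBlocks E8N 0 0
      (Matrix.fromBlocks E8N 0 0 minusTwo))))

/-- The bilinear form of the lattice with Gram matrix `B`. -/
def latForm {ι : Type} [Fintype ι] (B : Matrix ι ι ℤ) (x y : ι → ℤ) : ℤ :=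
  x ⬝ᵥ B.mulVec y

/-- `B` is the Gram matrix of an even lattice: symmetric, nondegenerate,
with even squares. -/
def IsEvenLattice {ι : Type} [Fintype ι] [DecidableEq ι]
    (B : Matrix ι ι ℤ) : Prop :=
  B.IsSymm ∧ B.det ≠ 0 ∧ ∀ i, 2 ∣ B i i

/-- The lattice with Gram matrix `B` is negative definite. -/
def IsNegDefLattice {ι : Type} [Fintype ι] (B : Matrix ι ι ℤ) : Prop :=
  ∀ x : ι → ℤ, x ≠ 0 → latForm B x x < 0

/-- `f` is a primitive embedding of the lattice with Gram matrix `BS` into the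
lattice with Gram matrix `BT`: an injective isometry with torsion-free
cokernel. -/
def IsPrimitiveEmbedding {ι κ : Type} [Fintype ι] [Fintype κ]
    (BS : Matrix ι ι ℤ) (BT : Matrix κ κ ℤ) (f : (ι → ℤ) →ₗ[ℤ] (κ → ℤ)) : Prop :=
  Function.Injective f ∧
  (∀ x y, latForm BT (f x) (f y) = latForm BS x y) ∧
  (∀ (x : κ → ℤ) (c : ℤ), c ≠ 0 → c • x ∈ LinearMap.range f →
    x ∈ LinearMap.range f)

section Padic

variable {p : ℕ} [hp : Fact p.Prime]

theorem PadicInt.isSquare_of_norm_sub_lt {z w : ℤ_[p]} (h : ‖w ^ 2 - z‖ < ‖2 * w‖ ^ 2) :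
    ∃ s : ℤ_[p], s ^ 2 = z := by
  have := hensels_lemma (p := p) (R := ℤ_[p]) (F := Polynomial.X ^ 2 - Polynomial.C z) (a := w)
    (by simpa [Polynomial.derivative_X_pow, one_add_one_eq_two] using h)
  obtain ⟨s, hs, -⟩ := this
  exact ⟨s, by simpa [sub_eq_zero] using hs⟩

theorem PadicInt.exists_sq_of_toZMod (hp2 : p ≠ 2) {z : ℤ_[p]} {w : ZMod p} (hw : w ≠ 0)
    (h : PadicInt.toZMod z = w ^ 2) : ∃ s : ℤ_[p], s ^ 2 = z := by
  obtain ⟨v, rfl⟩ := ZMod.ringHom_surjective (PadicInt.toZMod (p := p)) w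
  have hv : ‖v‖ = 1 := by
    by_contra hne
    apply hw
    rw [← RingHom.mem_ker, PadicInt.ker_toZMod, IsLocalRing.mem_maximalIdeal, PadicInt.mem_nonunits]
    exact lt_of_le_of_ne (PadicInt.norm_le_one v) hne
  have h2 : ‖(2 : ℤ_[p])‖ = 1 := by
    rw [← PadicInt.isUnit_iff]
    by_contra hne
    have h3 : PadicInt.toZMod (2 : ℤ_[p]) = 0 := by
      rwa [← RingHom.mem_ker, PadicInt.ker_toZMod, IsLocalRing.mem_maximalIdeal]
    have h4 : ((2 : ℕ) : ZMod p) = 0 := by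
      rw [← h3, ← map_natCast (PadicInt.toZMod (p := p))]; norm_num
    rw [ZMod.natCast_eq_zero_iff] at h4
    exact hp2 ((Nat.prime_dvd_prime_iff_eq hp.out Nat.prime_two).1 h4)
  apply PadicInt.isSquare_of_norm_sub_lt (w := v)
  rw [norm_mul, hv, h2, mul_one, one_pow, ← PadicInt.mem_nonunits,
    ← IsLocalRing.mem_maximalIdeal, ← PadicInt.ker_toZMod, RingHom.mem_ker]
  simp [h]

theorem PadicInt.exists_sq_of_toZModPow {z : ℤ_[2]}
    (h : PadicInt.toZModPow 3 z = 1) : ∃ s : ℤ_[2], s ^ 2 = z := by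
  apply PadicInt.isSquare_of_norm_sub_lt (w := 1)
  have h1 : (1 : ℤ_[2]) ^ 2 - z ∈ RingHom.ker (PadicInt.toZModPow (p := 2) 3) := by
    rw [RingHom.mem_ker]; simp [h]
  rw [PadicInt.ker_toZModPow, ← PadicInt.norm_le_pow_iff_mem_span_pow] at h1
  have h2 : ‖(2 : ℤ_[2])‖ = 1 / 2 := by
    have := PadicInt.norm_p (p := 2)
    simpa using this
  rw [mul_one, h2]
  refine lt_of_le_of_lt h1 ?_
  norm_num

/-- A solution modulo an odd prime of a binary diagonal unit form lifts. -/
theorem PadicInt.exists_binary_eq_unit (hp2 : p ≠ 2) (x u : ℤ_[p]ˣ) :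
    ∃ a b : ℤ_[p], a ^ 2 + x * b ^ 2 = u := by
  have hne : ∀ v : ℤ_[p]ˣ, PadicInt.toZMod (v : ℤ_[p]) ≠ 0 := fun v =>
    (v.isUnit.map (PadicInt.toZMod (p := p))).ne_zero
  obtain ⟨α, β, h⟩ : ∃ α β : ZMod p, α ^ 2 + PadicInt.toZMod (x : ℤ_[p]) * β ^ 2
      = PadicInt.toZMod (u : ℤ_[p]) := by
    have hx := hne x
    obtain ⟨α, β, h⟩ := FiniteField.exists_root_sum_quadratic (R := ZMod p)
      (f := Polynomial.X ^ 2)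
      (g := Polynomial.C (PadicInt.toZMod (x : ℤ_[p])) * Polynomial.X ^ 2
        - Polynomial.C (PadicInt.toZMod (u : ℤ_[p])))
      (Polynomial.degree_X_pow 2)
      (by
        rw [Polynomial.degree_sub_eq_left_of_degree_lt]
        · exact Polynomial.degree_C_mul_X_pow 2 hx
        · rw [Polynomial.degree_C_mul_X_pow 2 hx]
          exact lt_of_le_of_lt Polynomial.degree_C_le (by norm_num))
      (by simpa [ZMod.card] using hp.out.eq_two_or_odd.resolve_left hp2)
    refine ⟨α, β, ?_⟩
    simp at h
    linear_combination h
  obtain ⟨a, ha⟩ := ZMod.ringHom_surjective (PadicInt.toZMod (p := p)) α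
  obtain ⟨b, hb⟩ := ZMod.ringHom_surjective (PadicInt.toZMod (p := p)) β
  by_cases hα : α = 0
  · have hβ : β ≠ 0 := by
      rintro rfl
      apply hne u
      rw [← h, hα]; ring
    have hxx : PadicInt.toZMod (x : ℤ_[p]) * PadicInt.toZMod ((x⁻¹ : ℤ_[p]ˣ) : ℤ_[p]) = 1 := by
      rw [← map_mul, Units.mul_inv, map_one]
    obtain ⟨s, hs⟩ := PadicInt.exists_sq_of_toZMod hp2 hβ
      (z := (x⁻¹ : ℤ_[p]ˣ) * (u - a ^ 2)) (by
        rw [map_mul, map_sub, map_pow, ha, ← h]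
        linear_combination β ^ 2 * hxx)
    refine ⟨a, s, ?_⟩
    rw [hs, ← mul_assoc, Units.mul_inv]; ring
  · obtain ⟨s, hs⟩ := PadicInt.exists_sq_of_toZMod hp2 hα (z := u - x * b ^ 2) (by
        rw [map_sub, map_mul, map_pow, hb, ← h]; ring)
    exact ⟨s, b, by rw [hs]; ring⟩

theorem ZMod.eight_quaternary (x y t : ZMod 8) (hx : x * x = 1) (hy : y * y = 1)
    (ht : t * t = 1 ∨ t * t = 4) :
    ∃ a b c d : Fin 3, (a : ℕ) ^ 2 + x * (b : ℕ) ^ 2 + y * (c : ℕ) ^ 2 + x * y * (d : ℕ) ^ 2 = t ∧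
      (a = 1 ∨ b = 1 ∨ c = 1 ∨ d = 1) := by
  revert x y t
  decide +kernel

set_option synthInstance.maxSize 1000 in
theorem ZMod.eight_ramified (x u t : ZMod 8) (hx : x * x = 1) (hu : u * u = 1)
    (ht : t * t = 1) :
    ∃ a b c d : Fin 3, (a : ℕ) ^ 2 + x * (b : ℕ) ^ 2 + 2 * u * ((c : ℕ) ^ 2 + x * (d : ℕ) ^ 2) = t ∧
      (a = 1 ∨ b = 1) := by
  revert x u t
  decide +kernel

theorem PadicInt.toZModPow_unit_sq (x : ℤ_[2]ˣ) :
    PadicInt.toZModPow 3 (x : ℤ_[2]) * PadicInt.toZModPow 3 (x : ℤ_[2]) = 1 := by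
  have h : PadicInt.toZModPow 3 (x : ℤ_[2]) * PadicInt.toZModPow 3 ((x⁻¹ : ℤ_[2]ˣ) : ℤ_[2]) =
      1 := by
    rw [← map_mul, Units.mul_inv, map_one]
  have key : ∀ a b : ZMod 8, a * b = 1 → a * a = 1 := by decide
  exact key _ _ h

/-- If `c * 1 + r ≡ t` modulo `8`, then `c * s ^ 2 + r = t` is solvable in `ℤ_[2]`. -/
theorem PadicInt.exists_sq_lift (c : ℤ_[2]ˣ) (r t : ℤ_[2])
    (h : PadicInt.toZModPow 3 (c : ℤ_[2]) + PadicInt.toZModPow 3 r = PadicInt.toZModPow 3 t) :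
    ∃ s : ℤ_[2], c * s ^ 2 + r = t := by
  have hcc : PadicInt.toZModPow 3 (c : ℤ_[2]) * PadicInt.toZModPow 3 ((c⁻¹ : ℤ_[2]ˣ) : ℤ_[2]) =
      1 := by
    rw [← map_mul, Units.mul_inv, map_one]
  obtain ⟨s, hs⟩ := PadicInt.exists_sq_of_toZModPow (z := (c⁻¹ : ℤ_[2]ˣ) * (t - r)) (by
    rw [map_mul, map_sub, ← h]; linear_combination hcc)
  refine ⟨s, ?_⟩
  rw [hs, ← mul_assoc, Units.mul_inv]; ring

theorem PadicInt.exists_quaternary_eq (x y : ℤ_[p]ˣ) (t : ℤ_[p])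
    (ht : IsUnit t ∨ ∃ u : ℤ_[p]ˣ, t = p * u) :
    ∃ a b c d : ℤ_[p], a ^ 2 + x * b ^ 2 + y * c ^ 2 + x * y * d ^ 2 = t := by
  by_cases hp2 : p = 2
  · subst hp2
    have htt : PadicInt.toZModPow 3 t * PadicInt.toZModPow 3 t = 1 ∨
        PadicInt.toZModPow 3 t * PadicInt.toZModPow 3 t = 4 := by
      rcases ht with ⟨u, rfl⟩ | ⟨u, rfl⟩
      · exact Or.inl (PadicInt.toZModPow_unit_sq u)
      · right
        have := PadicInt.toZModPow_unit_sq u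
        rw [map_mul, map_natCast]
        push_cast
        linear_combination 4 * this
    obtain ⟨a, b, c, d, h, h1⟩ := ZMod.eight_quaternary _ _ _ (PadicInt.toZModPow_unit_sq x)
      (PadicInt.toZModPow_unit_sq y) htt
    rcases h1 with rfl | rfl | rfl | rfl
    · obtain ⟨s, hs⟩ := PadicInt.exists_sq_lift 1
        (x * (b : ℕ) ^ 2 + y * (c : ℕ) ^ 2 + x * y * (d : ℕ) ^ 2) t (by
          simp only [map_add, map_mul, map_pow, map_natCast, Units.val_one, map_one]
          rw [← h]; simp; ring)
      exact ⟨s, (b : ℕ), (c : ℕ), (d : ℕ), by rw [← hs]; push_cast; ring⟩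
    · obtain ⟨s, hs⟩ := PadicInt.exists_sq_lift x
        ((a : ℕ) ^ 2 + y * (c : ℕ) ^ 2 + x * y * (d : ℕ) ^ 2) t (by
          simp only [map_add, map_mul, map_pow, map_natCast]
          rw [← h]; simp; ring)
      exact ⟨(a : ℕ), s, (c : ℕ), (d : ℕ), by rw [← hs]; ring⟩
    · obtain ⟨s, hs⟩ := PadicInt.exists_sq_lift y
        ((a : ℕ) ^ 2 + x * (b : ℕ) ^ 2 + x * y * (d : ℕ) ^ 2) t (by
          simp only [map_add, map_mul, map_pow, map_natCast]
          rw [← h]; simp; ring)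
      exact ⟨(a : ℕ), (b : ℕ), s, (d : ℕ), by rw [← hs]; ring⟩
    · obtain ⟨s, hs⟩ := PadicInt.exists_sq_lift (x * y)
        ((a : ℕ) ^ 2 + x * (b : ℕ) ^ 2 + y * (c : ℕ) ^ 2) t (by
          simp only [map_add, map_mul, map_pow, map_natCast, Units.val_mul]
          rw [← h]; simp; ring)
      exact ⟨(a : ℕ), (b : ℕ), (c : ℕ), s, by rw [← hs]; push_cast; ring⟩
  · rcases ht with ⟨u, rfl⟩ | ⟨u, rfl⟩
    · obtain ⟨a, b, h⟩ := PadicInt.exists_binary_eq_unit hp2 x u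
      exact ⟨a, b, 0, 0, by rw [← h]; ring⟩
    · have hu : IsUnit ((p : ℤ_[p]) * u - y) := by
        by_contra hn
        have hm : (p : ℤ_[p]) * u - y ∈ IsLocalRing.maximalIdeal ℤ_[p] := hn
        have hpm : (p : ℤ_[p]) ∈ IsLocalRing.maximalIdeal ℤ_[p] := by
          rw [PadicInt.maximalIdeal_eq_span_p]; exact Ideal.mem_span_singleton_self _
        have : (y : ℤ_[p]) ∈ IsLocalRing.maximalIdeal ℤ_[p] := by
          simpa only [sub_sub_cancel] using
            Ideal.sub_mem _ (Ideal.mul_mem_right (u : ℤ_[p]) _ hpm) hm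
        exact this y.isUnit
      obtain ⟨v, hv⟩ := hu
      obtain ⟨a, b, h⟩ := PadicInt.exists_binary_eq_unit hp2 x v
      exact ⟨a, b, 1, 0, by rw [h, hv]; ring⟩

theorem PadicInt.exists_ramified_eq (x u t : ℤ_[p]ˣ) :
    ∃ a b c d : ℤ_[p], a ^ 2 + x * b ^ 2 + p * u * (c ^ 2 + x * d ^ 2) = t := by
  by_cases hp2 : p = 2
  · subst hp2
    obtain ⟨a, b, c, d, h, h1⟩ := ZMod.eight_ramified _ _ _ (PadicInt.toZModPow_unit_sq x)
      (PadicInt.toZModPow_unit_sq u) (PadicInt.toZModPow_unit_sq t)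
    rcases h1 with rfl | rfl
    · obtain ⟨s, hs⟩ := PadicInt.exists_sq_lift 1
        (x * (b : ℕ) ^ 2 + (2 : ℕ) * u * ((c : ℕ) ^ 2 + x * (d : ℕ) ^ 2)) t (by
          simp only [map_add, map_mul, map_pow, map_natCast, Units.val_one, map_one]
          rw [← h]; simp; ring)
      exact ⟨s, (b : ℕ), (c : ℕ), (d : ℕ), by rw [← hs]; push_cast; ring⟩
    · obtain ⟨s, hs⟩ := PadicInt.exists_sq_lift x
        ((a : ℕ) ^ 2 + (2 : ℕ) * u * ((c : ℕ) ^ 2 + x * (d : ℕ) ^ 2)) t (by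
          simp only [map_add, map_mul, map_pow, map_natCast]
          rw [← h]; simp; ring)
      exact ⟨(a : ℕ), s, (c : ℕ), (d : ℕ), by rw [← hs]; ring⟩
  · obtain ⟨a, b, h⟩ := PadicInt.exists_binary_eq_unit hp2 x t
    exact ⟨a, b, 0, 0, by rw [← h]; ring⟩

end Padic

section Norms

/-- `t` is a reduced norm of the quaternion algebra `(-x, -y)` over `F`. -/
def IsQuatNorm {F : Type*} [Field F] (x y t : F) : Prop :=
  ∃ a b c d : F, a ^ 2 + x * b ^ 2 + y * c ^ 2 + x * y * d ^ 2 = t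

namespace IsQuatNorm

variable {F : Type*} [Field F] {x y t s : F}

theorem symm (h : IsQuatNorm x y t) : IsQuatNorm y x t := by
  obtain ⟨a, b, c, d, h⟩ := h
  exact ⟨a, c, b, d, by rw [← h]; ring⟩

theorem sq_mul_left (hs : s ≠ 0) (h : IsQuatNorm x y t) : IsQuatNorm (s ^ 2 * x) y t := by
  obtain ⟨a, b, c, d, h⟩ := h
  exact ⟨a, b / s, c, d / s, by rw [← h]; field_simp⟩

theorem sq_mul_right (hs : s ≠ 0) (h : IsQuatNorm x y t) : IsQuatNorm x (s ^ 2 * y) t :=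
  (h.symm.sq_mul_left hs).symm

theorem sq_mul (h : IsQuatNorm x y t) (s : F) : IsQuatNorm x y (s ^ 2 * t) := by
  obtain ⟨a, b, c, d, h⟩ := h
  exact ⟨s * a, s * b, s * c, s * d, by rw [← h]; ring⟩

theorem mul_right (hx : x ≠ 0) (h : IsQuatNorm x y t) : IsQuatNorm x (x * y) t := by
  obtain ⟨a, b, c, d, h⟩ := h
  exact ⟨a, b, d, c / x, by rw [← h]; field_simp; ring⟩

end IsQuatNorm

theorem exists_rotation {F : Type*} [Field F] [CharZero F] {z q : F} (hz : z ≠ 0) (hq : q ≠ 0) :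
    ∃ a b : F, a ^ 2 + z * b ^ 2 = z * q ^ 2 ∧ a ≠ 0 := by
  obtain ⟨s, hs, h⟩ : ∃ s : F, s ≠ 0 ∧ 1 + z * s ^ 2 ≠ 0 := by
    by_cases h1 : 1 + z * 1 ^ 2 = 0
    · refine ⟨2, two_ne_zero, fun h2 => ?_⟩
      have : (3 : F) = 0 := by linear_combination 4 * h1 - h2
      exact three_ne_zero this
    · exact ⟨1, one_ne_zero, h1⟩
  refine ⟨2 * z * s * q / (1 + z * s ^ 2), q * (1 - z * s ^ 2) / (1 + z * s ^ 2), ?_, ?_⟩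
  · field_simp; ring
  · exact div_ne_zero (by simp [hz, hs, hq]) h

theorem IsQuatNorm.exists_ne_zero {F : Type*} [Field F] [CharZero F] {x y t : F} (hx : x ≠ 0)
    (hy : y ≠ 0) (ht : t ≠ 0) (h : IsQuatNorm x y t) :
    ∃ a b c d : F, a ^ 2 + x * b ^ 2 + y * c ^ 2 + x * y * d ^ 2 = t ∧ a ≠ 0 := by
  obtain ⟨a, b, c, d, h⟩ := h
  by_cases ha : a = 0
  · subst ha
    by_cases hb : b = 0
    · by_cases hc : c = 0
      · by_cases hd : d = 0
        · subst hb hc hd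
          exact absurd (by rw [← h]; ring) ht
        · obtain ⟨a', d', e, ha'⟩ := exists_rotation (mul_ne_zero hx hy) hd
          exact ⟨a', b, c, d', by linear_combination h + e, ha'⟩
      · obtain ⟨a', c', e, ha'⟩ := exists_rotation hy hc
        exact ⟨a', b, c', d, by linear_combination h + e, ha'⟩
    · obtain ⟨a', b', e, ha'⟩ := exists_rotation hx hb
      exact ⟨a', b', c, d, by linear_combination h + e, ha'⟩
  · exact ⟨a, b, c, d, h, ha⟩

variable {p : ℕ} [hp : Fact p.Prime]

theorem Padic.exists_sq_mul_unit {z : ℚ_[p]} (hz : z ≠ 0) :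
    ∃ s : ℚ_[p], s ≠ 0 ∧ ∃ u : ℤ_[p]ˣ, z = s ^ 2 * (u : ℤ_[p]) ∨ z = s ^ 2 * (p * (u : ℤ_[p])) := by
  have hp0 : (p : ℚ_[p]) ≠ 0 := by exact_mod_cast hp.out.ne_zero
  have hpr : (p : ℝ) ≠ 0 := by exact_mod_cast hp.out.ne_zero
  have hu : ‖z * (p : ℚ_[p]) ^ (-z.valuation)‖ = 1 := by
    rw [norm_mul, Padic.norm_eq_zpow_neg_valuation hz, Padic.norm_p_zpow, ← zpow_add₀ hpr]
    simp
  have hzz : z = (p : ℚ_[p]) ^ z.valuation * ((PadicInt.mkUnits hu : ℤ_[p]ˣ) : ℤ_[p]) := by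
    rw [PadicInt.mkUnits_eq, mul_comm z, ← mul_assoc, ← zpow_add₀ hp0]
    simp
  rcases Int.even_or_odd' z.valuation with ⟨k, hk | hk⟩
  · refine ⟨(p : ℚ_[p]) ^ k, zpow_ne_zero _ hp0, PadicInt.mkUnits hu, Or.inl ?_⟩
    rw [← zpow_natCast, ← _root_.zpow_mul, mul_comm k]
    push_cast
    rw [← hk]; exact hzz
  · refine ⟨(p : ℚ_[p]) ^ k, zpow_ne_zero _ hp0, PadicInt.mkUnits hu, Or.inr ?_⟩
    rw [← zpow_natCast, ← _root_.zpow_mul, mul_comm k, ← mul_assoc, ← zpow_add_one₀ hp0]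
    push_cast
    rw [← hk]; exact hzz

theorem Padic.isQuatNorm_unit_unit (x y w : ℤ_[p]ˣ) :
    IsQuatNorm ((x : ℤ_[p]) : ℚ_[p]) ((y : ℤ_[p]) : ℚ_[p]) ((w : ℤ_[p]) : ℚ_[p]) ∧
    IsQuatNorm ((x : ℤ_[p]) : ℚ_[p]) ((y : ℤ_[p]) : ℚ_[p]) (p * ((w : ℤ_[p]) : ℚ_[p])) := by
  constructor
  · obtain ⟨a, b, c, d, h⟩ := PadicInt.exists_quaternary_eq x y w (Or.inl w.isUnit)
    refine ⟨a, b, c, d, ?_⟩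
    have := congrArg ((↑) : ℤ_[p] → ℚ_[p]) h
    push_cast at this
    exact this
  · obtain ⟨a, b, c, d, h⟩ := PadicInt.exists_quaternary_eq x y (p * w) (Or.inr ⟨w, rfl⟩)
    refine ⟨a, b, c, d, ?_⟩
    have := congrArg ((↑) : ℤ_[p] → ℚ_[p]) h
    push_cast at this
    exact this

theorem Padic.isQuatNorm_unit_ramified (x y w : ℤ_[p]ˣ) :
    IsQuatNorm ((x : ℤ_[p]) : ℚ_[p]) (p * ((y : ℤ_[p]) : ℚ_[p])) ((w : ℤ_[p]) : ℚ_[p]) ∧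
    IsQuatNorm ((x : ℤ_[p]) : ℚ_[p]) (p * ((y : ℤ_[p]) : ℚ_[p])) (p * ((w : ℤ_[p]) : ℚ_[p])) := by
  constructor
  · obtain ⟨a, b, c, d, h⟩ := PadicInt.exists_ramified_eq x y w
    refine ⟨a, b, c, d, ?_⟩
    rw [← h]; push_cast; ring
  · obtain ⟨a, b, c, d, h⟩ := PadicInt.exists_ramified_eq x y⁻¹ (y⁻¹ * w)
    have hy : (y : ℤ_[p]) * ((y⁻¹ : ℤ_[p]ˣ) : ℤ_[p]) = 1 := Units.mul_inv y
    refine ⟨p * c, p * d, a, b, ?_⟩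
    have h' : (p * c) ^ 2 + x * (p * d) ^ 2 + (p * y) * a ^ 2 + x * (p * y) * b ^ 2
        = (p : ℤ_[p]) * w := by
      push_cast at h
      linear_combination p * y * h + ((p : ℤ_[p]) * w - p ^ 2 * (c ^ 2 + x * d ^ 2)) * hy
    have := congrArg ((↑) : ℤ_[p] → ℚ_[p]) h'
    push_cast at this
    exact this

/-- The reduced norm of a quaternion algebra over `ℚ_[p]` is surjective. -/
theorem Padic.isQuatNorm {x y t : ℚ_[p]} (hx : x ≠ 0) (hy : y ≠ 0) (ht : t ≠ 0) :
    IsQuatNorm x y t := by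
  have hp0 : (p : ℚ_[p]) ≠ 0 := by exact_mod_cast hp.out.ne_zero
  obtain ⟨r, hr, u, hx'⟩ := Padic.exists_sq_mul_unit hx
  obtain ⟨s, hs, v, hy'⟩ := Padic.exists_sq_mul_unit hy
  obtain ⟨q, hq, w, ht'⟩ := Padic.exists_sq_mul_unit ht
  have hu : ((u : ℤ_[p]) : ℚ_[p]) ≠ 0 := by simp
  have ramified : ∀ {z : ℚ_[p]}, IsQuatNorm (p * ((u : ℤ_[p]) : ℚ_[p]))
      (((u * v : ℤ_[p]ˣ) : ℤ_[p]) : ℚ_[p]) z →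
      IsQuatNorm (p * ((u : ℤ_[p]) : ℚ_[p])) (p * ((v : ℤ_[p]) : ℚ_[p])) z := by
    intro z h
    have := (h.mul_right (mul_ne_zero hp0 hu)).sq_mul_right (inv_ne_zero hu)
    convert this using 1
    push_cast
    field_simp
  rcases hx' with rfl | rfl <;> rcases hy' with rfl | rfl <;>
    refine IsQuatNorm.sq_mul_left hr (IsQuatNorm.sq_mul_right hs ?_) <;>
    rcases ht' with rfl | rfl <;> refine IsQuatNorm.sq_mul ?_ q
  · exact (Padic.isQuatNorm_unit_unit u v w).1
  · exact (Padic.isQuatNorm_unit_unit u v w).2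
  · exact (Padic.isQuatNorm_unit_ramified u v w).1
  · exact (Padic.isQuatNorm_unit_ramified u v w).2
  · exact (Padic.isQuatNorm_unit_ramified v u w).1.symm
  · exact (Padic.isQuatNorm_unit_ramified v u w).2.symm
  · exact ramified (Padic.isQuatNorm_unit_ramified (u * v) u w).1.symm
  · exact ramified (Padic.isQuatNorm_unit_ramified (u * v) u w).2.symm

end Norms

section Similitude

/-- If `-1 / δ` is a norm of the quaternion algebra `(-x, -y)`, then the form
`⟨1, x, y, x * y * δ⟩` has a similitude with multiplier `-1 / δ`. -/
theorem exists_similitude_of_norm {F : Type*} [Field F] {x y δ q₀ q₁ q₂ q₃ : F}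
    (hδ : δ ≠ 0) (hq : q₀ ≠ 0)
    (h : q₀ ^ 2 + x * q₁ ^ 2 + y * q₂ ^ 2 + x * y * q₃ ^ 2 = -1 / δ) :
    ∃ H : Matrix (Fin 4) (Fin 4) F,
      (-δ) • (Hᵀ * diagonal ![1, x, y, x * y * δ] * H) = diagonal ![1, x, y, x * y * δ] := by
  have h' : δ * (q₀ ^ 2 + x * q₁ ^ 2 + y * q₂ ^ 2 + x * y * q₃ ^ 2) + 1 = 0 := by
    rw [h]; field_simp; ring
  refine ⟨!![q₀ + x * y * q₃ ^ 2 / q₀, -x * q₁ - x * y * q₃ * q₂ / q₀,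
      -y * q₂ + x * y * q₃ * q₁ / q₀, -x * y * q₃ / q₀;
    q₁ - y * q₂ * q₃ / q₀, q₀ + y * q₂ ^ 2 / q₀, -y * q₃ - y * q₂ * q₁ / q₀, y * q₂ / q₀;
    q₂ + x * q₁ * q₃ / q₀, x * q₃ - x * q₁ * q₂ / q₀, q₀ + x * q₁ ^ 2 / q₀, -x * q₁ / q₀;
    -q₃ / (δ * q₀), q₂ / (δ * q₀), -q₁ / (δ * q₀), 1 / (δ * q₀)], ?_⟩
  ext i j
  fin_cases i <;> fin_cases j <;>
    simp [Matrix.mul_apply, Fin.sum_univ_four, Matrix.diagonal_apply] <;> field_simp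
  · linear_combination (-(q₀ ^ 2 + x * y * q₃ ^ 2)) * h'
  · right; linear_combination (-(x * y * q₃ * q₂)) * h'
  · right; linear_combination x * y * q₃ * q₁ * h'
  · right; linear_combination (-(x * y * q₃)) * h'
  · right; linear_combination (-(x * y * q₃ * q₂)) * h'
  · linear_combination (-(x * q₀ ^ 2 + x * y * q₂ ^ 2)) * h'
  · right; linear_combination (-(x * y * q₁ * q₂)) * h'
  · right; linear_combination x * y * q₂ * h'
  · right; linear_combination x * y * q₃ * q₁ * h'
  · right; linear_combination (-(x * y * q₁ * q₂)) * h'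
  · linear_combination (-(y * q₀ ^ 2 + x * y * q₁ ^ 2)) * h'
  · right; linear_combination (-(x * y * q₁)) * h'
  · right; linear_combination (-(x * y * q₃)) * h'
  · right; linear_combination x * y * q₂ * h'
  · right; linear_combination (-(x * y * q₁)) * h'
  · linear_combination (-(x * y)) * h'

end Similitude

section Approximation

variable {p : ℕ} [hp : Fact p.Prime]

theorem Padic.exists_similitude {a : Fin 4 → ℚ_[p]} (ha : ∀ i, a i ≠ 0) :
    ∃ H : Matrix (Fin 4) (Fin 4) ℚ_[p],
      (-(a 0 * a 3 / (a 1 * a 2))) • (Hᵀ * diagonal a * H) = diagonal a := by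
  have h0 := ha 0
  have h1 := ha 1
  have h2 := ha 2
  have h3 := ha 3
  have hx : a 1 / a 0 ≠ 0 := div_ne_zero h1 h0
  have hy : a 2 / a 0 ≠ 0 := div_ne_zero h2 h0
  have hδ : a 0 * a 3 / (a 1 * a 2) ≠ 0 := div_ne_zero (mul_ne_zero h0 h3) (mul_ne_zero h1 h2)
  have ht : -1 / (a 0 * a 3 / (a 1 * a 2)) ≠ 0 := div_ne_zero (neg_ne_zero.2 one_ne_zero) hδ
  obtain ⟨q₀, q₁, q₂, q₃, h, hq⟩ := (Padic.isQuatNorm hx hy ht).exists_ne_zero hx hy ht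
  obtain ⟨H, hH⟩ := exists_similitude_of_norm hδ hq h
  refine ⟨H, ?_⟩
  have hd : diagonal a = a 0 • diagonal ![1, a 1 / a 0, a 2 / a 0,
      a 1 / a 0 * (a 2 / a 0) * (a 0 * a 3 / (a 1 * a 2))] := by
    rw [← diagonal_smul]
    congr 1
    ext i
    fin_cases i <;> simp <;> field_simp
  rw [hd, Matrix.mul_smul, Matrix.smul_mul, smul_comm, hH]

theorem Padic.exists_rat_similitude (p : ℕ) [Fact p.Prime] {a : Fin 4 → ℚ} (ha : ∀ i, a i ≠ 0)
    {ε : ℝ} (hε : 0 < ε) :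
    ∃ h : Matrix (Fin 4) (Fin 4) ℚ, ∀ i j,
      ‖((((-(a 0 * a 3 / (a 1 * a 2))) • (hᵀ * diagonal a * h) - diagonal a) i j : ℚ) : ℚ_[p])‖
        < ε := by
  obtain ⟨H, hH⟩ := Padic.exists_similitude (p := p) (a := fun i => (a i : ℚ_[p]))
    (fun i => by exact_mod_cast ha i)
  set c : ℚ_[p] := -((a 0 : ℚ_[p]) * a 3 / (a 1 * a 2)) with hc
  set D : Matrix (Fin 4) (Fin 4) ℚ_[p] := diagonal fun i => (a i : ℚ_[p]) with hD
  have hcont : Continuous fun M : Matrix (Fin 4) (Fin 4) ℚ_[p] => c • (Mᵀ * D * M) - D :=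
    (((continuous_id.matrix_transpose.matrix_mul continuous_const).matrix_mul
      continuous_id).const_smul c).sub continuous_const
  have hopen : IsOpen {M : Matrix (Fin 4) (Fin 4) ℚ_[p] |
      ∀ i j, ‖(c • (Mᵀ * D * M) - D) i j‖ < ε} := by
    simp only [Set.ofPred_forall]
    refine isOpen_iInter_of_finite fun i => isOpen_iInter_of_finite fun j => ?_
    exact isOpen_lt (hcont.matrix_elem i j).norm continuous_const
  have hdense₁ : DenseRange (Pi.map fun _ : Fin 4 => ((↑) : ℚ → ℚ_[p])) :=
    DenseRange.piMap fun _ => Padic.denseRange_ratCast p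
  have hdense : DenseRange (Pi.map fun _ : Fin 4 => Pi.map fun _ : Fin 4 => ((↑) : ℚ → ℚ_[p])) :=
    DenseRange.piMap fun _ => hdense₁
  obtain ⟨(h : Matrix (Fin 4) (Fin 4) ℚ), hh⟩ := hdense.exists_mem_open hopen
    ⟨H, fun i j => by rw [hH]; simpa using hε⟩
  refine ⟨h, fun i j => ?_⟩
  convert hh i j using 2
  have e : ∀ M : Matrix (Fin 4) (Fin 4) ℚ, ((M i j : ℚ) : ℚ_[p])
    = (M.map (Rat.castHom ℚ_[p])) i j := fun M => rfl
  rw [e, Matrix.map_sub _ (map_sub _)]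
  have hD' : (diagonal a).map (Rat.castHom ℚ_[p]) = D := by
    rw [diagonal_map (map_zero _)]; rfl
  have h2 : ((-(a 0 * a 3 / (a 1 * a 2))) • (hᵀ * diagonal a * h)).map (Rat.castHom ℚ_[p])
      = c • ((hᵀ * diagonal a * h).map (Rat.castHom ℚ_[p])) := by
    ext i j
    simp [c]
  rw [h2, Matrix.map_mul, Matrix.map_mul, hD', transpose_map]
  rfl

end Approximation

section LocalGlobal

/-- The rational numbers whose denominator is prime to `p`. -/
def ratCoprimeDen (p : ℕ) : Subring ℚ where
  carrier := {q | q.den.Coprime p}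
  mul_mem' {a b} ha hb :=
    Nat.Coprime.coprime_dvd_left (Rat.mul_den_dvd a b) (Nat.Coprime.mul_left ha hb)
  one_mem' := by simp
  add_mem' {a b} ha hb :=
    Nat.Coprime.coprime_dvd_left (Rat.add_den_dvd a b) (Nat.Coprime.mul_left ha hb)
  zero_mem' := by simp
  neg_mem' {a} ha := by rw [Set.mem_ofPred_eq, Rat.neg_den]; exact ha

theorem mem_ratCoprimeDen {p : ℕ} {q : ℚ} : q ∈ ratCoprimeDen p ↔ q.den.Coprime p := Iff.rfl

theorem intCast_mem_ratCoprimeDen (p : ℕ) (n : ℤ) : (n : ℚ) ∈ ratCoprimeDen p := intCast_mem _ n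

theorem inv_natCast_mem_ratCoprimeDen {p n : ℕ} (h : n.Coprime p) :
    (n : ℚ)⁻¹ ∈ ratCoprimeDen p := by
  rcases Nat.eq_zero_or_pos n with rfl | hn
  · simp
  · rw [mem_ratCoprimeDen, Rat.inv_natCast_den_of_pos hn]
    exact h

theorem exists_intCast_eq_of_mem {q : ℚ} (h : ∀ p : ℕ, p.Prime → q ∈ ratCoprimeDen p) :
    ∃ n : ℤ, (n : ℚ) = q := by
  refine ⟨q.num, (Rat.den_eq_one_iff q).1 ?_⟩
  by_contra h1
  obtain ⟨p, hp, hpd⟩ := Nat.exists_prime_and_dvd h1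
  exact (hp.coprime_iff_not_dvd.1 (h p hp).symm) hpd

variable {ι : Type*} [Fintype ι]

theorem mulVec_mem_subring {κ : Type*} {R : Subring ℚ} {M : Matrix κ ι ℚ} (hM : ∀ i j, M i j ∈ R)
    {x : ι → ℚ}
    (hx : ∀ i, x i ∈ R) (i : κ) : (M *ᵥ x) i ∈ R :=
  sum_mem fun j _ => mul_mem (hM i j) (hx j)

theorem mul_mem_subring {κ l : Type*} {R : Subring ℚ} {M : Matrix κ ι ℚ} {N : Matrix ι l ℚ}
    (hM : ∀ i j, M i j ∈ R) (hN : ∀ i j, N i j ∈ R) (i : κ) (j : l) : (M * N) i j ∈ R :=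
  sum_mem fun k _ => mul_mem (hM i k) (hN k j)

theorem Matrix.exists_natCast_mul_eq_intCast {ι κ : Type*} [Fintype ι] [Fintype κ]
    (M : Matrix ι κ ℚ) :
    ∃ c : ℕ, c ≠ 0 ∧ ∀ i j, ∃ n : ℤ, (n : ℚ) = c * M i j := by
  refine ⟨∏ i, ∏ j, (M i j).den, ?_, fun i j => ?_⟩
  · exact Finset.prod_ne_zero_iff.2 fun i _ => Finset.prod_ne_zero_iff.2 fun j _ => (M i j).den_nz
  · obtain ⟨k, hk⟩ : (M i j).den ∣ ∏ i, ∏ j, (M i j).den :=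
      (Finset.dvd_prod_of_mem (fun j => (M i j).den) (Finset.mem_univ j)).trans
        (Finset.dvd_prod_of_mem (fun i => ∏ j, (M i j).den) (Finset.mem_univ i))
    refine ⟨k * (M i j).num, ?_⟩
    rw [hk]
    push_cast
    rw [mul_comm ((M i j).den : ℚ), mul_assoc, Rat.den_mul_eq_num]

theorem exists_common_denominator (P : Finset ℕ) (g : ℕ → Matrix ι ι ℚ) :
    ∃ c : ℕ, c ≠ 0 ∧ ∀ p ∈ P, ∀ i j, ∃ n : ℤ, (n : ℚ) = c * g p i j := by
  choose c hc h using fun p => (g p).exists_natCast_mul_eq_intCast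
  refine ⟨∏ p ∈ P, c p, Finset.prod_ne_zero_iff.2 fun p _ => hc p, fun p hp i j => ?_⟩
  obtain ⟨k, hk⟩ := Finset.dvd_prod_of_mem c hp
  obtain ⟨n, hn⟩ := h p i j
  refine ⟨k * n, ?_⟩
  rw [hk]
  push_cast
  rw [hn]
  ring

variable [DecidableEq ι]

/-- A family of local lattices `g p • ℤ_(p) ^ ι`, almost all of them trivial, comes from a
global one. -/
theorem exists_global_basis {g : ℕ → Matrix ι ι ℚ} {P : Finset ℕ} (hdet : ∀ p, IsUnit (g p).det)
    (hP : ∀ p ∉ P, g p = 1) :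
    ∃ b : Matrix ι ι ℚ, IsUnit b.det ∧ ∀ x : ι → ℚ,
      (∀ p : ℕ, p.Prime → ∀ i, ((g p)⁻¹ *ᵥ x) i ∈ ratCoprimeDen p) ↔
        ∃ z : ι → ℤ, x = b *ᵥ fun i => (z i : ℚ) := by
  obtain ⟨c₁, hc₁, h₁⟩ := exists_common_denominator P g
  obtain ⟨c₂, hc₂, h₂⟩ := exists_common_denominator P fun p => (g p)⁻¹
  have hc₁' : (c₁ : ℚ) ≠ 0 := by exact_mod_cast hc₁
  have hc₂' : (c₂ : ℚ) ≠ 0 := by exact_mod_cast hc₂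
  let N : Submodule ℤ (ι → ℚ) :=
    { carrier := {x | ∀ p : ℕ, p.Prime → ∀ i, ((g p)⁻¹ *ᵥ x) i ∈ ratCoprimeDen p}
      add_mem' := fun {x y} hx hy p hp i => by
        rw [mulVec_add]; exact add_mem (hx p hp i) (hy p hp i)
      zero_mem' := fun p hp i => by simp
      smul_mem' := fun n x hx p hp i => by
        rw [mulVec_smul]; exact zsmul_mem (hx p hp i) n }
  let castL : (ι → ℤ) →ₗ[ℤ] (ι → ℚ) := (Algebra.linearMap ℤ ℚ).compLeft ι
  have castL_apply : ∀ z i, castL z i = (z i : ℚ) := fun z i => rfl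
  have hsub : ∀ z : ι → ℤ, (c₂ : ℤ) • castL z ∈ N := by
    intro z p hp i
    by_cases hpP : p ∈ P
    · have : ((g p)⁻¹ *ᵥ ((c₂ : ℤ) • castL z)) = ((c₂ : ℚ) • (g p)⁻¹) *ᵥ castL z := by
        rw [smul_mulVec, mulVec_smul]
        ext; simp
      rw [this]
      refine mulVec_mem_subring (fun i j => ?_) (fun i => intCast_mem_ratCoprimeDen p _) i
      obtain ⟨n, hn⟩ := h₂ p hpP i j
      rw [Matrix.smul_apply, smul_eq_mul, ← hn]
      exact intCast_mem_ratCoprimeDen p _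
    · rw [hP p hpP]
      simpa [castL_apply] using
        mul_mem (natCast_mem (ratCoprimeDen p) c₂) (intCast_mem_ratCoprimeDen p (z i))
  have hsup : ∀ x ∈ N, ∀ i, ∃ n : ℤ, (n : ℚ) = c₁ * x i := by
    intro x hx i
    refine exists_intCast_eq_of_mem fun p hp => ?_
    by_cases hpP : p ∈ P
    · have : (c₁ : ℚ) * x i = (((c₁ : ℚ) • g p) *ᵥ ((g p)⁻¹ *ᵥ x)) i := by
        rw [mulVec_mulVec, Matrix.smul_mul, mul_nonsing_inv _ (hdet p), smul_mulVec, one_mulVec]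
        rfl
      rw [this]
      refine mulVec_mem_subring (fun i j => ?_) (hx p hp) i
      obtain ⟨n, hn⟩ := h₁ p hpP i j
      rw [Matrix.smul_apply, smul_eq_mul, ← hn]
      exact intCast_mem_ratCoprimeDen p _
    · have := hx p hp i
      rw [hP p hpP] at this
      simp only [inv_one, one_mulVec] at this
      exact mul_mem (natCast_mem _ c₁) this
  let φ : (ι → ℤ) →ₗ[ℤ] (ι → ℚ) :=
    ((LinearMap.lsmul ℚ (ι → ℚ) (c₁ : ℚ)⁻¹).restrictScalars ℤ) ∘ₗ castL
  have φ_apply : ∀ z i, φ z i = (c₁ : ℚ)⁻¹ * z i := fun z i => rfl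
  let N' : Submodule ℤ (ι → ℤ) := N.comap φ
  have hrank : Module.finrank ℤ N' = Fintype.card ι := by
    apply le_antisymm
    · simpa using LinearMap.finrank_le_finrank_of_injective N'.injective_subtype
    · let ψ : (ι → ℤ) →ₗ[ℤ] N' := ((c₁ * c₂ : ℤ) • LinearMap.id).codRestrict N' fun z => by
        have : φ ((c₁ * c₂ : ℤ) • z) = (c₂ : ℤ) • castL z := by
          ext i
          simp [φ_apply, castL_apply]
          field_simp
        show φ ((c₁ * c₂ : ℤ) • z) ∈ N
        rw [this]
        exact hsub z
      have hψ : Function.Injective ψ := by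
        intro z w h
        have h' : (c₁ * c₂ : ℤ) • z = (c₁ * c₂ : ℤ) • w := congrArg Subtype.val h
        exact smul_right_injective _ (by exact_mod_cast mul_ne_zero hc₁ hc₂) h'
      simpa using LinearMap.finrank_le_finrank_of_injective hψ
  let e : Module.Basis ι ℤ N' := (Module.finBasisOfFinrankEq ℤ N' hrank).reindex
    (Fintype.equivFin ι).symm
  let b : Matrix ι ι ℚ := Matrix.of fun i j => φ (e j : ι → ℤ) i
  have hb : ∀ z : ι → ℤ, (b *ᵥ fun i => (z i : ℚ)) = φ (∑ j, z j • (e j : ι → ℤ)) := by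
    intro z
    ext i
    simp only [b, mulVec, dotProduct, of_apply, map_sum, Finset.sum_apply]
    refine Finset.sum_congr rfl fun j _ => ?_
    rw [map_zsmul, Pi.smul_apply, zsmul_eq_mul, mul_comm]
  have hbmem : ∀ x : ι → ℚ, x ∈ N ↔ ∃ z : ι → ℤ, x = b *ᵥ fun i => (z i : ℚ) := by
    intro x
    constructor
    · intro hx
      choose y hy using hsup x hx
      have hy' : φ y = x := by
        ext i
        rw [φ_apply, hy]
        field_simp
      have hyN : y ∈ N' := by
        show φ y ∈ N
        rwa [hy']
      refine ⟨e.repr ⟨y, hyN⟩, ?_⟩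
      have := congrArg Subtype.val (e.sum_repr ⟨y, hyN⟩)
      rw [hb, ← hy']
      congr 1
      rw [AddSubmonoidClass.coe_finsetSum] at this
      exact this.symm
    · rintro ⟨z, rfl⟩
      rw [hb]
      show (∑ j, z j • (e j : ι → ℤ)) ∈ N'
      exact sum_mem fun j _ => N'.smul_mem _ (e j).2
  refine ⟨b, ?_, hbmem⟩
  have : ∀ j, ∃ z : ι → ℤ, (c₂ : ℤ) • castL (Pi.single j 1) = b *ᵥ fun i => (z i : ℚ) :=
    fun j => (hbmem _).1 (hsub _)
  choose z hz using this
  have hbz : b * Matrix.of (fun i j => (z j i : ℚ)) = (c₂ : ℚ) • 1 := by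
    ext i j
    have := congrFun (hz j) i
    simp only [Pi.smul_apply, castL_apply] at this
    rw [Matrix.smul_apply, Matrix.one_apply, Matrix.mul_apply]
    simp only [Pi.single_apply, mulVec, dotProduct] at this
    simpa [eq_comm] using this.symm
  have hdet' := congrArg Matrix.det hbz
  rw [det_mul, det_smul, det_one, mul_one] at hdet'
  exact isUnit_of_mul_isUnit_left (y := (Matrix.of (fun i j => (z j i : ℚ))).det)
    (by rw [hdet']; exact (pow_ne_zero _ hc₂').isUnit)

end LocalGlobal

section LocalGlobalGram

variable {ι : Type*} [Fintype ι] [DecidableEq ι]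

theorem inv_mul_basis_mem {g : ℕ → Matrix ι ι ℚ} {b : Matrix ι ι ℚ}
    (hb : ∀ x : ι → ℚ, (∀ p : ℕ, p.Prime → ∀ i, ((g p)⁻¹ *ᵥ x) i ∈ ratCoprimeDen p) ↔
        ∃ z : ι → ℤ, x = b *ᵥ fun i => (z i : ℚ)) {p : ℕ} (hp : p.Prime) (i j : ι) :
    ((g p)⁻¹ * b) i j ∈ ratCoprimeDen p := by
  have := (hb (b *ᵥ Pi.single j 1)).2 ⟨Pi.single j 1, by
    congr 1; ext i; simp [Pi.single_apply, apply_ite]⟩ p hp i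
  rw [mulVec_mulVec] at this
  simpa using this

theorem inv_basis_mul_mem {g : ℕ → Matrix ι ι ℚ} {P : Finset ℕ} (hdet : ∀ p, IsUnit (g p).det)
    (hP : ∀ p ∉ P, g p = 1) {b : Matrix ι ι ℚ} (hbdet : IsUnit b.det)
    (hb : ∀ x : ι → ℚ, (∀ p : ℕ, p.Prime → ∀ i, ((g p)⁻¹ *ᵥ x) i ∈ ratCoprimeDen p) ↔
        ∃ z : ι → ℤ, x = b *ᵥ fun i => (z i : ℚ)) {p : ℕ} (hp : p.Prime) (i j : ι) :
    (b⁻¹ * g p) i j ∈ ratCoprimeDen p := by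
  obtain ⟨c, hc, h⟩ : ∃ c : ℕ, c ≠ 0 ∧ ∀ l, ∀ i j, ∃ n : ℤ, (n : ℚ) = c * ((g l)⁻¹ * g p) i j := by
    obtain ⟨c₁, hc₁, h₁⟩ := exists_common_denominator P fun l => (g l)⁻¹ * g p
    obtain ⟨c₂, hc₂, h₂⟩ := (g p).exists_natCast_mul_eq_intCast
    refine ⟨c₁ * c₂, mul_ne_zero hc₁ hc₂, fun l i j => ?_⟩
    by_cases hl : l ∈ P
    · obtain ⟨n, hn⟩ := h₁ l hl i j
      exact ⟨c₂ * n, by push_cast; rw [hn]; ring⟩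
    · obtain ⟨n, hn⟩ := h₂ i j
      refine ⟨c₁ * n, ?_⟩
      push_cast
      rw [hn, hP l hl]
      simp [mul_assoc]
  obtain ⟨k, d, hd, rfl⟩ := Nat.exists_eq_pow_mul_and_not_dvd hc p hp.ne_one
  have hd0 : (d : ℚ) ≠ 0 := by
    rintro h0
    exact hd (by rw [Nat.cast_eq_zero.1 h0]; exact dvd_zero p)
  have hp0 : (p : ℚ) ≠ 0 := by exact_mod_cast hp.ne_zero
  obtain ⟨z, hz⟩ := (hb ((d : ℚ) • (g p *ᵥ Pi.single j 1))).1 fun l hl i => by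
    rw [mulVec_smul, mulVec_mulVec]
    simp only [mulVec_single_one, Pi.smul_apply, col_apply, smul_eq_mul]
    by_cases hlp : l = p
    · subst hlp
      rw [nonsing_inv_mul _ (hdet l), Matrix.one_apply]
      split_ifs
      · simp
      · simp
    · obtain ⟨n, hn⟩ := h l i j
      have : (d : ℚ) * ((g l)⁻¹ * g p) i j = ((p ^ k : ℕ) : ℚ)⁻¹ * n := by
        rw [hn]
        push_cast
        field_simp
      rw [this]
      exact mul_mem (inv_natCast_mem_ratCoprimeDen
        (Nat.Coprime.pow_left k ((Nat.coprime_primes hp hl).2 (Ne.symm hlp))))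
        (intCast_mem_ratCoprimeDen _ _)
  have hz' : ((d : ℚ) • (b⁻¹ * g p)) *ᵥ Pi.single j 1 = fun i => (z i : ℚ) := by
    rw [smul_mulVec, ← mulVec_mulVec, ← mulVec_smul, hz, mulVec_mulVec, nonsing_inv_mul _ hbdet,
      one_mulVec]
  have := congrFun hz' i
  simp only [mulVec_single_one, col_apply, Matrix.smul_apply, smul_eq_mul] at this
  have : (b⁻¹ * g p) i j = (d : ℚ)⁻¹ * z i := by
    rw [← this]
    field_simp
  rw [this]
  exact mul_mem (inv_natCast_mem_ratCoprimeDen ((Nat.Prime.coprime_iff_not_dvd hp).2 hd).symm)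
    (intCast_mem_ratCoprimeDen _ _)

/-- A rational quadratic space having an even unimodular lattice at every prime, almost
everywhere the standard one, has a global even unimodular lattice. -/
theorem exists_even_unimodular_of_local {B : Matrix ι ι ℚ} (hB : IsUnit B.det)
    (hBsymm : B.IsSymm) {g : ℕ → Matrix ι ι ℚ} {P : Finset ℕ}
    (hdet : ∀ p, IsUnit (g p).det) (hP : ∀ p ∉ P, g p = 1)
    (hint : ∀ p : ℕ, p.Prime → ∀ i j, ((g p)ᵀ * B * g p) i j ∈ ratCoprimeDen p)
    (hinv : ∀ p : ℕ, p.Prime → ∀ i j, ((g p)ᵀ * B * g p)⁻¹ i j ∈ ratCoprimeDen p)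
    (heven : ∃ T : Matrix ι ι ℚ, (∀ i j, T i j ∈ ratCoprimeDen 2) ∧
      (g 2)ᵀ * B * g 2 = T + Tᵀ) :
    ∃ (b : Matrix ι ι ℚ) (C : Matrix ι ι ℤ), IsUnit b.det ∧
      C.map (Int.castRingHom ℚ) = bᵀ * B * b ∧ C.IsSymm ∧ (∀ i, 2 ∣ C i i) ∧ IsUnit C.det ∧
      ∀ x : ι → ℚ, (∀ p : ℕ, p.Prime → ∀ i, ((g p)⁻¹ *ᵥ x) i ∈ ratCoprimeDen p) ↔
        ∃ z : ι → ℤ, x = b *ᵥ fun i => (z i : ℚ) := by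
  obtain ⟨b, hbdet, hb⟩ := exists_global_basis hdet hP
  have hgb : ∀ p, g p * ((g p)⁻¹ * b) = b := fun p => by
    rw [← Matrix.mul_assoc, mul_nonsing_inv _ (hdet p), Matrix.one_mul]
  have hgram : ∀ p, bᵀ * B * b =
      ((g p)⁻¹ * b)ᵀ * (((g p)ᵀ * B * g p) * ((g p)⁻¹ * b)) := by
    intro p
    conv_lhs => rw [← hgb p]
    simp only [transpose_mul, Matrix.mul_assoc]
  have hgram_inv : ∀ p, (bᵀ * B * b)⁻¹ =
      (b⁻¹ * g p) * (((g p)ᵀ * B * g p)⁻¹ * (b⁻¹ * g p)ᵀ) := by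
    intro p
    simp only [Matrix.mul_inv_rev, transpose_mul, transpose_nonsing_inv, Matrix.mul_assoc]
    rw [mul_nonsing_inv_cancel_left _ _ (hdet p),
      nonsing_inv_mul_cancel_left _ _ (by simpa only [det_transpose] using hdet p)]
  have hC : ∀ i j, ∃ n : ℤ, (n : ℚ) = (bᵀ * B * b) i j := fun i j =>
    exists_intCast_eq_of_mem fun p hp => by
      rw [hgram p]
      exact mul_mem_subring (fun i j => inv_mul_basis_mem hb hp j i)
        (mul_mem_subring (hint p hp) (inv_mul_basis_mem hb hp)) i j
  have hCinv : ∀ i j, ∃ n : ℤ, (n : ℚ) = (bᵀ * B * b)⁻¹ i j := fun i j =>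
    exists_intCast_eq_of_mem fun p hp => by
      rw [hgram_inv p]
      exact mul_mem_subring (inv_basis_mul_mem hdet hP hbdet hb hp)
        (mul_mem_subring (hinv p hp) fun i j => inv_basis_mul_mem hdet hP hbdet hb hp j i) i j
  choose C hC using hC
  choose C' hC' using hCinv
  have hCm : (Matrix.of C).map (Int.castRingHom ℚ) = bᵀ * B * b := by
    ext i j; exact hC i j
  have hCm' : (Matrix.of C').map (Int.castRingHom ℚ) = (bᵀ * B * b)⁻¹ := by
    ext i j; exact hC' i j
  have hinj : Function.Injective fun M : Matrix ι ι ℤ => M.map (Int.castRingHom ℚ) :=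
    Matrix.map_injective (RingHom.injective_int _)
  refine ⟨b, Matrix.of C, hbdet, hCm, ?_, ?_, ?_, hb⟩
  · apply hinj
    show (Matrix.of C)ᵀ.map _ = (Matrix.of C).map _
    rw [transpose_map, hCm]
    simp only [transpose_mul, transpose_transpose, hBsymm.eq, Matrix.mul_assoc]
  · intro i
    obtain ⟨T, hT, hTB⟩ := heven
    have h2 := hgram 2
    rw [hTB, add_mul, Matrix.mul_add] at h2
    set Z := (g 2)⁻¹ * b with hZ
    have hZT : ∀ i j, (Zᵀ * (T * Z)) i j ∈ ratCoprimeDen 2 :=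
      mul_mem_subring (fun i j => inv_mul_basis_mem hb Nat.prime_two j i)
        (mul_mem_subring hT (inv_mul_basis_mem hb Nat.prime_two))
    have hT' : Zᵀ * (Tᵀ * Z) = (Zᵀ * (T * Z))ᵀ := by simp [Matrix.mul_assoc]
    have hCi : (C i i : ℚ) = 2 * (Zᵀ * (T * Z)) i i := by
      rw [hC, h2, hT', Matrix.add_apply, transpose_apply, two_mul]
    have hhalf : ((C i i : ℚ) / 2) ∈ ratCoprimeDen 2 := by
      rw [hCi, mul_div_cancel_left₀ _ two_ne_zero]
      exact hZT i i
    by_contra hodd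
    have hden : ((C i i : ℚ) / (2 : ℤ)).den = 2 := by
      have := Rat.den_div_eq_of_coprime (a := C i i) (b := 2) two_pos
        ((Int.isCoprime_iff_gcd_eq_one.1
          ((Int.prime_two.coprime_iff_not_dvd).2 hodd).symm))
      exact_mod_cast this
    rw [mem_ratCoprimeDen] at hhalf
    rw [show (C i i : ℚ) / 2 = (C i i : ℚ) / (2 : ℤ) by norm_num, hden] at hhalf
    norm_num at hhalf
  · have hunit : IsUnit (bᵀ * B * b).det := by
      rw [det_mul, det_mul, det_transpose]
      exact (hbdet.mul hB).mul hbdet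
    have h1 : Matrix.of C * Matrix.of C' = 1 := by
      apply hinj
      show (Matrix.of C * Matrix.of C').map _ = _
      rw [Matrix.map_mul, hCm, hCm', mul_nonsing_inv _ hunit]
      simp
    exact isUnit_det_of_right_inverse h1

end LocalGlobalGram

section Twist

variable {ι κ : Type*} [Fintype ι] [DecidableEq ι] [Fintype κ] [DecidableEq κ]

theorem inv_one_add_mul_mem {p : ℕ} (hp : p.Prime) {s : ℚ} (hs : s ∈ ratCoprimeDen p) :
    1 + p * s ≠ 0 ∧ (1 + p * s)⁻¹ ∈ ratCoprimeDen p := by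
  have hd : (s.den : ℚ) ≠ 0 := by exact_mod_cast s.den_nz
  have hs' : ¬ p ∣ s.den := fun h => hp.coprime_iff_not_dvd.1 (mem_ratCoprimeDen.1 hs).symm h
  have e : 1 + p * s = ((s.den + p * s.num : ℤ) : ℚ) / s.den := by
    push_cast
    rw [← Rat.mul_den_eq_num]
    field_simp
  have hnd : ¬ (p : ℤ) ∣ s.den + p * s.num := by
    rw [Int.dvd_add_left (dvd_mul_right _ _)]
    exact_mod_cast hs'
  have hn0 : (s.den + p * s.num : ℤ) ≠ 0 := fun h => hnd (h ▸ dvd_zero _)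
  have hcop : (s.den + p * s.num : ℤ).natAbs.Coprime p :=
    (hp.coprime_iff_not_dvd.2 fun h => hnd (Int.natCast_dvd.2 h)).symm
  refine ⟨?_, ?_⟩
  · rw [e]
    exact div_ne_zero (by exact_mod_cast hn0) hd
  · rw [e, inv_div, div_eq_mul_inv]
    refine mul_mem (natCast_mem _ _) ?_
    have := inv_natCast_mem_ratCoprimeDen hcop
    generalize (s.den + p * s.num : ℤ) = m at this
    rcases Int.natAbs_eq m with h | h
    · rwa [h, Int.cast_natCast]
    · rw [h, Int.cast_neg, Int.cast_natCast, inv_neg]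
      exact neg_mem this

theorem inv_add_smul_mem {p : ℕ} (hp : p.Prime) {G G' E : Matrix ι ι ℚ} (hG : G * G' = 1)
    (hG' : ∀ i j, G' i j ∈ ratCoprimeDen p) (hE : ∀ i j, E i j ∈ ratCoprimeDen p) :
    IsUnit (G + (p : ℚ) • E).det ∧ ∀ i j, (G + (p : ℚ) • E)⁻¹ i j ∈ ratCoprimeDen p := by
  have hE' := mul_mem_subring hG' hE
  let L : Matrix ι ι (ratCoprimeDen p) := Matrix.of fun i j => ⟨(G' * E) i j, hE' i j⟩
  have hL : L.map (ratCoprimeDen p).subtype = G' * E := rfl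
  have hdet : IsUnit (1 + (p : ratCoprimeDen p) • L).det := by
    rw [Matrix.det_one_add_smul]
    set s :=
      (det (1 + (Polynomial.X : Polynomial (ratCoprimeDen p)) • L.map Polynomial.C)).divX.divX.eval
      (p : ratCoprimeDen p)
    obtain ⟨h0, h1⟩ := inv_one_add_mul_mem hp (s := ((L.trace + s * p : ratCoprimeDen p) : ℚ))
      (SetLike.coe_mem _)
    refine IsUnit.of_mul_eq_one ⟨_, h1⟩ (Subtype.ext ?_)
    refine Eq.trans ?_ (mul_inv_cancel₀ h0)
    push_cast
    ring
  obtain ⟨N, hN⟩ : ∃ N, (1 + (p : ratCoprimeDen p) • L) * N = 1 :=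
    ⟨_, mul_nonsing_inv _ hdet⟩
  have hN' : (1 + (p : ℚ) • (G' * E)) * N.map (ratCoprimeDen p).subtype = 1 := by
    have := congrArg (fun M => M.map (ratCoprimeDen p).subtype) hN
    simp only [Matrix.map_mul] at this
    rw [Matrix.map_add _ (map_add _), Matrix.map_one _ (map_zero _) (map_one _)] at this
    rw [← this, ← hL]
    congr 2
  have hinv : (G + (p : ℚ) • E) * (N.map (ratCoprimeDen p).subtype * G') = 1 := by
    have e : G + (p : ℚ) • E = G * (1 + (p : ℚ) • (G' * E)) := by
      rw [Matrix.mul_add, Matrix.mul_smul, ← Matrix.mul_assoc, hG, Matrix.one_mul, Matrix.mul_one]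
    rw [e, ← Matrix.mul_assoc, Matrix.mul_assoc G, hN', Matrix.mul_one, hG]
  refine ⟨isUnit_det_of_right_inverse hinv, ?_⟩
  rw [inv_eq_right_inv hinv]
  exact mul_mem_subring (fun i j => SetLike.coe_mem (N i j)) hG'

/-- The form `G` rescaled by `c` on the span of the columns of `w`, where `S * w = 1`
and `Sᵀ * D = G * w`. -/
theorem twisted_gram {G : Matrix ι ι ℚ} {w : Matrix ι κ ℚ} {S : Matrix κ ι ℚ} {D : Matrix κ κ ℚ}
    (hSw : S * w = 1) (hGw : G * w = Sᵀ * D) (hwG : wᵀ * G = D * S) (c : ℚ) (h : Matrix κ κ ℚ) :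
    (1 + w * ((h - 1) * S))ᵀ * (G + (c - 1) • (Sᵀ * (D * S))) * (1 + w * ((h - 1) * S)) =
      G + Sᵀ * ((c • (hᵀ * D * h) - D) * S) := by
  have hwS : wᵀ * Sᵀ = 1 := by rw [← transpose_mul, hSw, transpose_one]
  have hwS' : ∀ X : Matrix κ ι ℚ, wᵀ * (Sᵀ * X) = X := fun X => by
    rw [← Matrix.mul_assoc, hwS, Matrix.one_mul]
  have hSw' : ∀ X : Matrix κ ι ℚ, S * (w * X) = X := fun X => by
    rw [← Matrix.mul_assoc, hSw, Matrix.one_mul]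
  have hGw' : ∀ X : Matrix κ ι ℚ, G * (w * X) = Sᵀ * (D * X) := fun X => by
    rw [← Matrix.mul_assoc, hGw, Matrix.mul_assoc]
  simp only [transpose_add, transpose_one, transpose_mul, transpose_sub, Matrix.add_mul,
    Matrix.mul_add,
    Matrix.sub_mul, Matrix.mul_sub, Matrix.one_mul, Matrix.mul_one, Matrix.mul_assoc, hGw', hSw',
    hwS', hwG,
    Matrix.smul_mul, Matrix.mul_smul]
  module

theorem twisted_mul_inv {G G' : Matrix ι ι ℚ} {w : Matrix ι κ ℚ} {S : Matrix κ ι ℚ}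
    {D D' : Matrix κ κ ℚ} (hSw : S * w = 1) (hGw : G * w = Sᵀ * D) (hwG : wᵀ * G = D * S)
    (hG : G * G' = 1) (hD : D * D' = 1) {c : ℚ} (hc : c ≠ 0) :
    (G + (c - 1) • (Sᵀ * (D * S))) * (G' + (c⁻¹ - 1) • (w * (D' * wᵀ))) = 1 := by
  have hSw' : ∀ X : Matrix κ ι ℚ, S * (w * X) = X := fun X => by
    rw [← Matrix.mul_assoc, hSw, Matrix.one_mul]
  have hGw' : ∀ X : Matrix κ ι ℚ, G * (w * X) = Sᵀ * (D * X) := fun X => by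
    rw [← Matrix.mul_assoc, hGw, Matrix.mul_assoc]
  have hDD' : ∀ X : Matrix κ ι ℚ, D * (D' * X) = X := fun X => by
    rw [← Matrix.mul_assoc, hD, Matrix.one_mul]
  have hDSG : D * (S * G') = wᵀ := by
    rw [← Matrix.mul_assoc, ← hwG, Matrix.mul_assoc, hG, Matrix.mul_one]
  simp only [Matrix.add_mul, Matrix.mul_add, Matrix.mul_assoc, Matrix.smul_mul, Matrix.mul_smul,
    hG, hGw', hDD', hSw', hDSG]
  have : (c⁻¹ - 1) + (c - 1) + (c - 1) * (c⁻¹ - 1) = 0 := by field_simp; ring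
  have := congrArg (fun r : ℚ => r • (Sᵀ * wᵀ)) this
  simp only [zero_smul] at this
  conv_rhs => rw [← add_zero (1 : Matrix ι ι ℚ), ← this]
  module

theorem mem_ratCoprimeDen_of_norm_le {p : ℕ} [hp : Fact p.Prime] {q : ℚ} (h : ‖(q : ℚ_[p])‖ ≤ 1) :
    q ∈ ratCoprimeDen p := by
  rw [Padic.norm_rat_le_one_iff_padicValuation_le_one, Rat.padicValuation_le_one_iff] at h
  exact (hp.out.coprime_iff_not_dvd.2 h).symm

end Twist

section TwistedLattice

theorem exists_similitude_mod {p : ℕ} (hp : p.Prime) {a : Fin 4 → ℤ} (ha : ∀ i, a i ≠ 0) :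
    ∃ h : Matrix (Fin 4) (Fin 4) ℚ, ∀ i j,
      (((-(a 0 * a 3 / (a 1 * a 2) : ℚ)) • (hᵀ * diagonal (fun i => (a i : ℚ)) * h) -
        diagonal fun i => (a i : ℚ)) i j) / (a i * a j * p) ∈ ratCoprimeDen p := by
  have : Fact p.Prime := ⟨hp⟩
  have hp0 : (p : ℚ) ≠ 0 := by exact_mod_cast hp.ne_zero
  have ha' : ∀ i, (a i : ℚ) ≠ 0 := fun i => by exact_mod_cast ha i
  set m : ℚ := p * (∏ i, a i : ℤ) * (∏ i, a i : ℤ) with hm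
  have hprod : ((∏ i, a i : ℤ) : ℚ) ≠ 0 := by
    exact_mod_cast Finset.prod_ne_zero_iff.2 fun i _ => ha i
  have hm0 : m ≠ 0 := mul_ne_zero (mul_ne_zero hp0 hprod) hprod
  have hm0' : (m : ℚ_[p]) ≠ 0 := by exact_mod_cast hm0
  obtain ⟨h, hh⟩ := Padic.exists_rat_similitude p ha' (norm_pos_iff.2 hm0')
  refine ⟨h, fun i j => ?_⟩
  have h1 := hh i j
  generalize ((-(a 0 * a 3 / (a 1 * a 2) : ℚ)) • (hᵀ * diagonal (fun i => (a i : ℚ)) * h) -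
        diagonal fun i => (a i : ℚ)) i j = F at h1
  have h2 : F / m ∈ ratCoprimeDen p := by
    refine mem_ratCoprimeDen_of_norm_le ?_
    rw [Rat.cast_div, norm_div]
    exact (div_le_one (norm_pos_iff.2 hm0')).2 h1.le
  obtain ⟨u, hu⟩ : a i ∣ ∏ i, a i := Finset.dvd_prod_of_mem a (Finset.mem_univ i)
  obtain ⟨v, hv⟩ : a j ∣ ∏ i, a i := Finset.dvd_prod_of_mem a (Finset.mem_univ j)
  have hu0 : (u : ℚ) ≠ 0 := by
    rintro h0
    rw [Int.cast_eq_zero.1 h0, mul_zero] at hu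
    exact hprod (by exact_mod_cast hu)
  have hv0 : (v : ℚ) ≠ 0 := by
    rintro h0
    rw [Int.cast_eq_zero.1 h0, mul_zero] at hv
    exact hprod (by exact_mod_cast hv)
  have h3 : F / (a i * a j * p) = F / m * ((u * v : ℤ) : ℚ) := by
    have hm' : m = p * ((a i * u : ℤ) : ℚ) * ((a j * v : ℤ) : ℚ) := by rw [hm, ← hu, ← hv]
    have := ha' i
    have := ha' j
    rw [hm']
    push_cast
    field_simp
  rw [h3]
  exact mul_mem h2 (intCast_mem_ratCoprimeDen p _)

variable {ι κ : Type*} [Fintype ι] [Fintype κ] [DecidableEq κ]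

/-- The form which equals `c` times `G` on the span of the columns of `w`, and `G` on its
orthogonal complement, where `wᵀ * G * w = diagonal a`. -/
def twistedForm (G : Matrix ι ι ℚ) (w : Matrix ι κ ℚ) (a : κ → ℚ) (c : ℚ) : Matrix ι ι ℚ :=
  G + (c - 1) • ((diagonal (fun i => (a i)⁻¹) * (wᵀ * G))ᵀ *
    (diagonal a * (diagonal (fun i => (a i)⁻¹) * (wᵀ * G))))

theorem inv_intCast_mem_ratCoprimeDen {p : ℕ} (hp : p.Prime) {m : ℤ} (hm : ¬ (p : ℤ) ∣ m) :
    (m : ℚ)⁻¹ ∈ ratCoprimeDen p := by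
  have := inv_natCast_mem_ratCoprimeDen (n := m.natAbs)
    (hp.coprime_iff_not_dvd.2 fun h => hm (Int.natCast_dvd.2 h)).symm
  rcases Int.natAbs_eq m with h | h
  · rwa [h, Int.cast_natCast]
  · rw [h, Int.cast_neg, Int.cast_natCast, inv_neg]
    exact neg_mem this

theorem exists_twisted_lattice [DecidableEq ι] {T G : Matrix ι ι ℤ} (hT : G = T + Tᵀ)
    (hdet : IsUnit G.det) {w : Matrix ι (Fin 4) ℤ} {a : Fin 4 → ℤ} (ha : ∀ i, a i ≠ 0)
    (hw : wᵀ * G * w = diagonal a) :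
    ∃ (b : Matrix ι ι ℚ) (C : Matrix ι ι ℤ), IsUnit b.det ∧
      C.map (Int.castRingHom ℚ) = bᵀ * twistedForm (G.map (Int.castRingHom ℚ))
        (w.map (Int.castRingHom ℚ)) (fun i => (a i : ℚ)) (-(a 0 * a 3 / (a 1 * a 2))) * b ∧
      C.IsSymm ∧ (∀ i, 2 ∣ C i i) ∧ IsUnit C.det ∧
      ∀ x : ι → ℚ, ((w.map (Int.castRingHom ℚ))ᵀ * G.map (Int.castRingHom ℚ)) *ᵥ x = 0 →
        ((∀ i, ∃ n : ℤ, (n : ℚ) = x i) ↔ ∃ z : ι → ℤ, x = b *ᵥ fun i => (z i : ℚ)) := by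
  have ha' : ∀ i, (a i : ℚ) ≠ 0 := fun i => by exact_mod_cast ha i
  set c : ℚ := -(a 0 * a 3 / (a 1 * a 2)) with hc
  have hc0 : c ≠ 0 := neg_ne_zero.2
    (div_ne_zero (mul_ne_zero (ha' 0) (ha' 3)) (mul_ne_zero (ha' 1) (ha' 2)))
  set Gq := G.map (Int.castRingHom ℚ) with hGq
  set wq := w.map (Int.castRingHom ℚ) with hwq
  set D : Matrix (Fin 4) (Fin 4) ℚ := diagonal fun i => (a i : ℚ) with hD
  set D' : Matrix (Fin 4) (Fin 4) ℚ := diagonal fun i => (a i : ℚ)⁻¹ with hD'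
  set S := D' * (wqᵀ * Gq) with hS
  have hDD' : D * D' = 1 := by
    rw [hD, hD', diagonal_mul_diagonal]
    simp [ha']
  have hD'D : D' * D = 1 := by
    rw [hD, hD', diagonal_mul_diagonal]
    simp [ha']
  have hGsymm : Gqᵀ = Gq := by
    rw [hGq, ← transpose_map, hT, transpose_add, transpose_transpose, add_comm]
  have hww : wqᵀ * Gq * wq = D := by
    rw [hwq, hGq, ← transpose_map, ← Matrix.map_mul, ← Matrix.map_mul, hw,
      diagonal_map (map_zero _)]
    rfl
  have hSw : S * wq = 1 := by
    rw [hS, Matrix.mul_assoc, hww, hD'D]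
  have hwG : wqᵀ * Gq = D * S := by
    rw [hS, ← Matrix.mul_assoc, hDD', Matrix.one_mul]
  have hGw : Gq * wq = Sᵀ * D := by
    have := congrArg Matrix.transpose hwG
    rwa [transpose_mul, transpose_mul, transpose_transpose, hGsymm, hD, diagonal_transpose] at this
  have hGint : ∀ p i j, Gq i j ∈ ratCoprimeDen p := fun p i j => intCast_mem_ratCoprimeDen p _
  have hwint : ∀ p i j, wq i j ∈ ratCoprimeDen p := fun p i j => intCast_mem_ratCoprimeDen p _
  have hKint : ∀ p i j, (wqᵀ * Gq) i j ∈ ratCoprimeDen p := fun p =>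
    mul_mem_subring (fun i j => hwint p j i) (hGint p)
  set G' := (G⁻¹).map (Int.castRingHom ℚ) with hG'
  have hGG' : Gq * G' = 1 := by
    rw [hGq, hG', ← Matrix.map_mul, mul_nonsing_inv _ hdet]
    exact Matrix.map_one _ (map_zero _) (map_one _)
  have hG'int : ∀ p i j, G' i j ∈ ratCoprimeDen p := fun p i j => intCast_mem_ratCoprimeDen p _
  set B := twistedForm Gq wq (fun i => (a i : ℚ)) c with hB
  have hBdef : B = Gq + (c - 1) • (Sᵀ * (D * S)) := rfl
  have hBinv := twisted_mul_inv hSw hGw hwG hGG' hDD' hc0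
  rw [← hBdef] at hBinv
  have hBsymm : B.IsSymm := by
    rw [Matrix.IsSymm, hBdef]
    simp only [transpose_add, transpose_smul, transpose_mul, transpose_transpose, hGsymm, hD,
      diagonal_transpose, Matrix.mul_assoc]
  have hloc : ∀ p : ℕ, ∃ h : Matrix (Fin 4) (Fin 4) ℚ, p.Prime → ∀ i j,
      ((c • (hᵀ * D * h) - D) i j) / (a i * a j * p) ∈ ratCoprimeDen p := fun p => by
    by_cases hp : p.Prime
    · obtain ⟨h, hh⟩ := exists_similitude_mod hp ha
      exact ⟨h, fun _ => hh⟩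
    · exact ⟨0, fun h => absurd h hp⟩
  choose h hh using hloc
  set P : Finset ℕ := (2 * ∏ i, a i).natAbs.primeFactors with hP
  have hm0 : (2 * ∏ i, a i) ≠ 0 :=
    mul_ne_zero two_ne_zero (Finset.prod_ne_zero_iff.2 fun i _ => ha i)
  have hPprime : ∀ p ∈ P, p.Prime := fun p hp => Nat.prime_of_mem_primeFactors hp
  have hPmem : ∀ p : ℕ, p.Prime → p ∉ P → ¬ (p : ℤ) ∣ 2 * ∏ i, a i := fun p hp hpP hd =>
    hpP (Nat.mem_primeFactors.2 ⟨hp, Int.natCast_dvd.1 hd, Int.natAbs_ne_zero.2 hm0⟩)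
  let g : ℕ → Matrix ι ι ℚ := fun p => if p ∈ P then 1 + wq * ((h p - 1) * S) else 1
  have hg1 : ∀ p ∉ P, g p = 1 := fun p hp => if_neg hp
  have hbad : ∀ p ∈ P, ∃ E : Matrix ι ι ℚ, (∀ i j, E i j ∈ ratCoprimeDen p) ∧
      (g p)ᵀ * B * g p = Gq + (p : ℚ) • E := by
    intro p hp
    have hp0 : (p : ℚ) ≠ 0 := by exact_mod_cast (hPprime p hp).ne_zero
    let R : Matrix (Fin 4) (Fin 4) ℚ := Matrix.of fun i j =>
      ((c • ((h p)ᵀ * D * h p) - D) i j) / (a i * a j * p)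
    have hR : D' * ((c • ((h p)ᵀ * D * h p) - D) * D') = (p : ℚ) • R := by
      ext i j
      have := ha' i
      have := ha' j
      rw [hD', diagonal_mul, mul_diagonal]
      change _ = (p : ℚ) * (((c • ((h p)ᵀ * D * h p) - D) i j) / (a i * a j * p))
      generalize (c • ((h p)ᵀ * D * h p) - D) i j = F
      field_simp
    refine ⟨(wqᵀ * Gq)ᵀ * (R * (wqᵀ * Gq)), mul_mem_subring (fun i j => hKint p j i)
      (mul_mem_subring (hh p (hPprime p hp)) (hKint p)), ?_⟩
    have hgp : g p = 1 + wq * ((h p - 1) * S) := if_pos hp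
    rw [hgp, hBdef, twisted_gram hSw hGw hwG]
    congr 1
    have hD'T : D'ᵀ = D' := by rw [hD', diagonal_transpose]
    have hST : Sᵀ = (wqᵀ * Gq)ᵀ * D' := by rw [hS, transpose_mul, hD'T]
    have hpR : (p : ℚ) • ((wqᵀ * Gq)ᵀ * (R * (wqᵀ * Gq))) =
        (wqᵀ * Gq)ᵀ * (((p : ℚ) • R) * (wqᵀ * Gq)) := by
      rw [Matrix.smul_mul, Matrix.mul_smul]
    rw [hpR, ← hR, hST, hS]
    simp only [Matrix.mul_assoc]
  have hgdet : ∀ p, IsUnit (g p).det := by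
    intro p
    by_cases hp : p ∈ P
    · obtain ⟨E, hE, hE'⟩ := hbad p hp
      have := (inv_add_smul_mem (hPprime p hp) hGG' (hG'int p) hE).1
      rw [← hE', det_mul] at this
      exact isUnit_of_mul_isUnit_right this
    · rw [hg1 p hp, det_one]
      exact isUnit_one
  have hgood : ∀ p : ℕ, p.Prime → p ∉ P → ∀ i, (a i : ℚ)⁻¹ ∈ ratCoprimeDen p :=
    fun p hp hpP i => inv_intCast_mem_ratCoprimeDen hp fun hd => hPmem p hp hpP
      ((hd.trans (Finset.dvd_prod_of_mem a (Finset.mem_univ i))).mul_left 2)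
  have ha_int : ∀ p i, (a i : ℚ) ∈ ratCoprimeDen p := fun p i => intCast_mem_ratCoprimeDen p _
  have hD'int : ∀ p : ℕ, p.Prime → p ∉ P → ∀ i j, D' i j ∈ ratCoprimeDen p := by
    intro p hp hpP i j
    rw [hD', diagonal_apply]
    split_ifs
    · exact hgood p hp hpP i
    · exact zero_mem _
  have hgood_int : ∀ p : ℕ, p.Prime → p ∉ P → ∀ i j, B i j ∈ ratCoprimeDen p := by
    intro p hp hpP i j
    have hc_int : c ∈ ratCoprimeDen p := by
      rw [hc, div_eq_mul_inv, mul_inv]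
      exact neg_mem (mul_mem (mul_mem (ha_int p 0) (ha_int p 3))
        (mul_mem (hgood p hp hpP 1) (hgood p hp hpP 2)))
    have hSint : ∀ i j, S i j ∈ ratCoprimeDen p :=
      mul_mem_subring (hD'int p hp hpP) (hKint p)
    rw [hBdef, ← hwG]
    exact add_mem (hGint p i j) (mul_mem (sub_mem hc_int (one_mem _))
      (mul_mem_subring (fun i j => hSint j i) (hKint p) i j))
  have hgood_inv : ∀ p : ℕ, p.Prime → p ∉ P → ∀ i j, B⁻¹ i j ∈ ratCoprimeDen p := by
    intro p hp hpP i j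
    have hc_int : c⁻¹ ∈ ratCoprimeDen p := by
      rw [hc, inv_neg, inv_div, div_eq_mul_inv, mul_inv]
      exact neg_mem (mul_mem (mul_mem (ha_int p 1) (ha_int p 2))
        (mul_mem (hgood p hp hpP 0) (hgood p hp hpP 3)))
    rw [inv_eq_right_inv hBinv]
    exact add_mem (hG'int p i j) (mul_mem (sub_mem hc_int (one_mem _))
      (mul_mem_subring (hwint p) (mul_mem_subring (hD'int p hp hpP) fun i j => hwint p j i) i j))
  obtain ⟨b, C, hb, hC, hsymm, heven, hCdet, hbx⟩ := exists_even_unimodular_of_local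
    (isUnit_det_of_right_inverse hBinv) hBsymm hgdet hg1
    (fun p hp i j => by
      by_cases hpP : p ∈ P
      · obtain ⟨E, hE, hE'⟩ := hbad p hpP
        rw [hE']
        exact add_mem (hGint p i j) (mul_mem (natCast_mem _ p) (hE i j))
      · rw [hg1 p hpP, transpose_one, Matrix.one_mul, Matrix.mul_one]
        exact hgood_int p hp hpP i j)
    (fun p hp i j => by
      by_cases hpP : p ∈ P
      · obtain ⟨E, hE, hE'⟩ := hbad p hpP
        rw [hE']
        exact (inv_add_smul_mem hp hGG' (hG'int p) hE).2 i j
      · rw [hg1 p hpP, transpose_one, Matrix.one_mul, Matrix.mul_one]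
        exact hgood_inv p hp hpP i j)
    (by
      have h2 : 2 ∈ P := Nat.mem_primeFactors.2
        ⟨Nat.prime_two, Int.natCast_dvd.1 (dvd_mul_right _ _), Int.natAbs_ne_zero.2 hm0⟩
      obtain ⟨E, hE, hE'⟩ := hbad 2 h2
      have hET : Eᵀ = E := by
        have h3 := congrArg Matrix.transpose hE'
        have h4 : ((g 2)ᵀ * B * g 2)ᵀ = (g 2)ᵀ * B * g 2 := by
          simp only [transpose_mul, transpose_transpose, hBsymm.eq, Matrix.mul_assoc]
        rw [h4, hE', transpose_add, hGsymm, transpose_smul] at h3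
        exact (smul_right_injective _ (two_ne_zero (α := ℚ)) (add_left_cancel h3)).symm
      refine ⟨T.map (Int.castRingHom ℚ) + E,
        fun i j => add_mem (intCast_mem_ratCoprimeDen 2 _) (hE i j), ?_⟩
      rw [hE', hGq, hT, Matrix.map_add _ (map_add _), transpose_add, hET, ← transpose_map]
      push_cast
      module)
  refine ⟨b, C, hb, hC, hsymm, heven, hCdet, fun x hx => ?_⟩
  rw [← hbx]
  have hgx : ∀ p, (g p)⁻¹ *ᵥ x = x := by
    intro p
    have : g p *ᵥ x = x := by
      by_cases hp : p ∈ P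
      · have hgp : g p = 1 + wq * ((h p - 1) * S) := if_pos hp
        rw [hgp, hS, add_mulVec, one_mulVec]
        simp only [← Matrix.mul_assoc] at hx ⊢
        rw [Matrix.mul_assoc _ _ Gq, ← mulVec_mulVec, hx, mulVec_zero, add_zero]
      · rw [hg1 p hp, one_mulVec]
    conv_lhs => rw [← this]
    rw [mulVec_mulVec, nonsing_inv_mul _ (hgdet p), one_mulVec]
  simp only [hgx]
  constructor
  · intro hx p _ i
    obtain ⟨n, hn⟩ := hx i
    rw [← hn]
    exact intCast_mem_ratCoprimeDen p n
  · exact fun hx i => exists_intCast_eq_of_mem fun p hp => hx p hp i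

end TwistedLattice

section Signature

variable {V : Type*} [AddCommGroup V] [Module ℚ V]

/-- If `B` is positive definite on an `n`-dimensional space and every vector has an orthogonal
projection to the subspace `F`, on which `B` is nonpositive, then `B` has `n` pairwise orthogonal
positive vectors orthogonal to `F`. -/
theorem LinearMap.BilinForm.exists_orthogonal_positive {B : LinearMap.BilinForm ℚ V}
    (hB : B.IsSymm) {κ : Type*} [Fintype κ] (P : (κ → ℚ) →ₗ[ℚ] V)
    (hP : ∀ c, c ≠ 0 → 0 < B (P c) (P c)) {F : Submodule ℚ V} (hF : ∀ s ∈ F, B s s ≤ 0)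
    (hproj : ∀ x, ∃ s ∈ F, ∀ t ∈ F, B (x - s) t = 0) :
    ∀ n ≤ Fintype.card κ, ∃ w : Fin n → V, (∀ i j, i ≠ j → B (w i) (w j) = 0) ∧
      (∀ i, 0 < B (w i) (w i)) ∧ ∀ i, ∀ t ∈ F, B (w i) t = 0 := by
  intro n
  induction n with
  | zero => exact fun _ => ⟨Fin.elim0, fun i => i.elim0, fun i => i.elim0, fun i => i.elim0⟩
  | succ n ih =>
    intro hn
    obtain ⟨w, horth, hpos, hwF⟩ := ih (Nat.le_of_succ_le hn)
    let φ : (κ → ℚ) →ₗ[ℚ] (Fin n → ℚ) := LinearMap.pi fun i => (B (w i)).comp P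
    have hker : LinearMap.ker φ ≠ ⊥ := LinearMap.ker_ne_bot_of_finrank_lt (by
      simpa using hn)
    obtain ⟨c, hc, hc0⟩ := (Submodule.ne_bot_iff _).1 hker
    have hwc : ∀ i, B (w i) (P c) = 0 := fun i => congrFun hc i
    obtain ⟨s, hs, hst⟩ := hproj (P c)
    set y := P c - s with hy
    have hPc : P c = y + s := by rw [hy, sub_add_cancel]
    have hwy : ∀ i, B (w i) y = 0 := fun i => by
      rw [hy, map_sub, hwc, hwF i s hs, sub_zero]
    have hyy : 0 < B y y := by
      have h1 := hP c hc0
      have h2 : B s y = 0 := by rw [hB.eq, hst s hs]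
      rw [hPc] at h1
      simp only [map_add, LinearMap.add_apply, h2, hst s hs] at h1
      linarith [hF s hs]
    refine ⟨Fin.cons y w, ?_, ?_, ?_⟩
    · refine Fin.cases (Fin.cases (fun h => absurd rfl h) fun j _ => ?_)
        fun i => Fin.cases (fun _ => ?_) fun j hij => ?_
      · simpa using (hB.eq _ _).trans (hwy j)
      · simpa using hwy i
      · simpa using horth i j fun h => hij (h ▸ rfl)
    · exact Fin.cases (by simpa using hyy) fun i => by simpa using hpos i
    · exact Fin.cases (by simpa using hst) fun i => by simpa using hwF i

/-- If `B` is negative definite on a subspace of codimension `n` and has `n` pairwise orthogonal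
positive vectors, then it is negative definite on their orthogonal complement. -/
theorem LinearMap.BilinForm.neg_of_orthogonal_positive {B : LinearMap.BilinForm ℚ V}
    (hB : B.IsSymm) {κ μ : Type*} [Fintype κ] [Fintype μ] [DecidableEq μ]
    (hκ : Fintype.card κ = Fintype.card μ)
    (l : V →ₗ[ℚ] (κ → ℚ)) (hl : ∀ x, l x = 0 → x ≠ 0 → B x x < 0) {w : μ → V}
    (horth : ∀ i j, i ≠ j → B (w i) (w j) = 0) (hpos : ∀ i, 0 < B (w i) (w i)) {y : V}
    (hy : ∀ i, B (w i) y = 0) (hy0 : y ≠ 0) : B y y < 0 := by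
  by_contra! hyy
  let ψ : (μ → ℚ) × ℚ →ₗ[ℚ] V := (Fintype.linearCombination ℚ w).coprod
    (LinearMap.toSpanSingleton ℚ V y)
  have hψ : ∀ c t, ψ (c, t) = ∑ i, c i • w i + t • y := fun c t => rfl
  have hker : LinearMap.ker (l.comp ψ) ≠ ⊥ := LinearMap.ker_ne_bot_of_finrank_lt (by
    simp [hκ])
  obtain ⟨⟨c, t⟩, hc, hc0⟩ := (Submodule.ne_bot_iff _).1 hker
  have hwv : ∀ i, B (w i) (ψ (c, t)) = c i * B (w i) (w i) := by
    intro i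
    rw [hψ, map_add, map_smul, hy, map_sum, Finset.sum_eq_single i]
    · simp
    · intro j _ hj
      rw [map_smul, horth i j hj.symm, smul_zero]
    · simp
  have hyv : B y (ψ (c, t)) = t * B y y := by
    rw [hψ, map_add, map_smul, map_sum, Finset.sum_eq_zero]
    · simp
    · intro j _
      rw [map_smul, hB.eq, hy, smul_zero]
  have hvv : B (ψ (c, t)) (ψ (c, t)) = ∑ i, c i * (c i * B (w i) (w i)) + t * (t * B y y) := by
    have h1 : B (ψ (c, t)) = ∑ i, c i • B (w i) + t • B y := by simp [hψ]
    rw [h1, LinearMap.add_apply, LinearMap.sum_apply, LinearMap.smul_apply, hyv]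
    simp [hwv]
  have hnonneg : 0 ≤ B (ψ (c, t)) (ψ (c, t)) := by
    rw [hvv]
    refine add_nonneg (Finset.sum_nonneg fun i _ => ?_) ?_
    · rw [← mul_assoc]
      exact mul_nonneg (mul_self_nonneg _) (hpos i).le
    · rw [← mul_assoc]
      exact mul_nonneg (mul_self_nonneg _) hyy
  have hv0 : ψ (c, t) = 0 := by
    by_contra h0
    exact absurd (hl _ hc h0) hnonneg.not_gt
  have hci : c = 0 := by
    ext i
    have := hwv i
    rw [hv0, map_zero] at this
    exact (mul_eq_zero.1 this.symm).resolve_right (hpos i).ne'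
  subst hci
  rw [hψ] at hv0
  have ht : t = 0 := by simpa [hy0] using hv0
  exact hc0 (by rw [ht]; rfl)

end Signature

section UnimodularEven

/-- `G` is an even unimodular Gram matrix of a form which is negative definite on the common
kernel of a family of functionals indexed by `κ`, and positive definite on the image of `κ → ℚ`
under some linear map. -/
structure IsEvenUnimodularOfIndex {ι : Type*} [Fintype ι] [DecidableEq ι] (G : Matrix ι ι ℤ)
    (κ : Type*) [Fintype κ] : Prop where
  exists_eq_add_transpose : ∃ T, G = T + Tᵀ
  isUnit_det : IsUnit G.det
  exists_neg : ∃ l : (ι → ℚ) →ₗ[ℚ] (κ → ℚ), ∀ x, l x = 0 → x ≠ 0 →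
    x ⬝ᵥ G.map (Int.castRingHom ℚ) *ᵥ x < 0
  exists_pos : ∃ P : (κ → ℚ) →ₗ[ℚ] (ι → ℚ), ∀ c, c ≠ 0 →
    0 < P c ⬝ᵥ G.map (Int.castRingHom ℚ) *ᵥ P c

theorem dotProduct_fromBlocks_mulVec {R ι κ : Type*} [CommRing R] [Fintype ι] [Fintype κ]
    (A : Matrix ι ι R) (D : Matrix κ κ R) (x y : ι ⊕ κ → R) :
    x ⬝ᵥ fromBlocks A 0 0 D *ᵥ y =
      (x ∘ Sum.inl) ⬝ᵥ A *ᵥ (y ∘ Sum.inl) + (x ∘ Sum.inr) ⬝ᵥ D *ᵥ (y ∘ Sum.inr) := by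
  rw [fromBlocks_mulVec, dotProduct_block]
  simp

theorem IsEvenUnimodularOfIndex.fromBlocks {ι ι' κ κ' : Type*} [Fintype ι] [DecidableEq ι]
    [Fintype ι'] [DecidableEq ι'] [Fintype κ] [Fintype κ'] {A : Matrix ι ι ℤ}
    {D : Matrix ι' ι' ℤ} (hA : IsEvenUnimodularOfIndex A κ) (hD : IsEvenUnimodularOfIndex D κ') :
    IsEvenUnimodularOfIndex (fromBlocks A 0 0 D) (κ ⊕ κ') := by
  obtain ⟨⟨T, hT⟩, hdet, ⟨l, hl⟩, P, hP⟩ := hA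
  obtain ⟨⟨T', hT'⟩, hdet', ⟨l', hl'⟩, P', hP'⟩ := hD
  have hmap : (Matrix.fromBlocks A 0 0 D).map (Int.castRingHom ℚ) =
      Matrix.fromBlocks (A.map (Int.castRingHom ℚ)) 0 0 (D.map (Int.castRingHom ℚ)) := by
    rw [fromBlocks_map, Matrix.map_zero _ (map_zero _), Matrix.map_zero _ (map_zero _)]
  refine ⟨⟨Matrix.fromBlocks T 0 0 T', ?_⟩, ?_, ⟨(LinearEquiv.sumArrowLequivProdArrow κ κ' ℚ ℚ).symm
    ∘ₗ (l.prodMap l') ∘ₗ (LinearEquiv.sumArrowLequivProdArrow ι ι' ℚ ℚ).toLinearMap, ?_⟩,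
    (LinearEquiv.sumArrowLequivProdArrow ι ι' ℚ ℚ).symm ∘ₗ (P.prodMap P') ∘ₗ
      (LinearEquiv.sumArrowLequivProdArrow κ κ' ℚ ℚ).toLinearMap, ?_⟩
  · rw [fromBlocks_transpose, fromBlocks_add, ← hT, ← hT']
    simp
  · rw [det_fromBlocks_zero₂₁]
    exact hdet.mul hdet'
  · intro x hx hx0
    have h1 : l (x ∘ Sum.inl) = 0 := by
      ext i
      exact congrFun hx (Sum.inl i)
    have h2 : l' (x ∘ Sum.inr) = 0 := by
      ext i
      exact congrFun hx (Sum.inr i)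
    rw [hmap, dotProduct_fromBlocks_mulVec]
    by_cases h3 : x ∘ Sum.inl = 0
    · have h4 : x ∘ Sum.inr ≠ 0 := fun h4 => hx0 (by
        ext i
        rcases i with i | i
        exacts [congrFun h3 i, congrFun h4 i])
      rw [h3, zero_dotProduct, zero_add]
      exact hl' _ h2 h4
    · refine add_neg_of_neg_of_nonpos (hl _ h1 h3) ?_
      by_cases h4 : x ∘ Sum.inr = 0
      · rw [h4, zero_dotProduct]
      · exact (hl' _ h2 h4).le
  · intro c hc0
    rw [hmap, dotProduct_fromBlocks_mulVec]
    change 0 < P (c ∘ Sum.inl) ⬝ᵥ _ *ᵥ P (c ∘ Sum.inl) + P' (c ∘ Sum.inr) ⬝ᵥ _ *ᵥ P' (c ∘ Sum.inr)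
    by_cases h3 : c ∘ Sum.inl = 0
    · have h4 : c ∘ Sum.inr ≠ 0 := fun h4 => hc0 (by
        ext i
        rcases i with i | i
        exacts [congrFun h3 i, congrFun h4 i])
      rw [h3, map_zero, zero_dotProduct, zero_add]
      exact hP' _ h4
    · refine add_pos_of_pos_of_nonneg (hP _ h3) ?_
      by_cases h4 : c ∘ Sum.inr = 0
      · rw [h4, map_zero, zero_dotProduct]
      · exact (hP' _ h4).le

theorem isEvenUnimodularOfIndex_UMat : IsEvenUnimodularOfIndex UMat (Fin 1) := by
  refine ⟨⟨!![0, 1; 0, 0], by decide⟩, by decide,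
    ⟨LinearMap.pi fun _ => LinearMap.proj (R := ℚ) (φ := fun _ : Fin 2 => ℚ) 0 + LinearMap.proj 1,
      fun x hx hx0 => ?_⟩,
    LinearMap.pi fun _ => (LinearMap.proj 0 : (Fin 1 → ℚ) →ₗ[ℚ] ℚ), fun c hc => ?_⟩
  · have h1 : x 0 + x 1 = 0 := congrFun hx 0
    have h2 : x 1 = - x 0 := by linarith
    have h3 : x 0 ≠ 0 := fun h3 => hx0 (by
      ext i
      fin_cases i <;> simp [h2, h3])
    simp [UMat, dotProduct, mulVec, Fin.sum_univ_two, h2]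
    nlinarith [mul_self_pos.2 h3]
  · have h3 : c 0 ≠ 0 := fun h3 => hc (by
      ext i
      rwa [Subsingleton.elim i 0])
    simp [UMat, dotProduct, mulVec, Fin.sum_univ_two]
    exact h3

theorem isEvenUnimodularOfIndex_E8N : IsEvenUnimodularOfIndex E8N (Fin 0) := by
  refine ⟨⟨!![-1, 0, 1, 0, 0, 0, 0, 0;
      0, -1, 0, 1, 0, 0, 0, 0;
      0, 0, -1, 1, 0, 0, 0, 0;
      0, 0, 0, -1, 1, 0, 0, 0;
      0, 0, 0, 0, -1, 1, 0, 0;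
      0, 0, 0, 0, 0, -1, 1, 0;
      0, 0, 0, 0, 0, 0, -1, 1;
      0, 0, 0, 0, 0, 0, 0, -1], by decide⟩, ?_, ⟨0, fun x _ hx0 => ?_⟩,
    0, fun c hc => absurd (Subsingleton.elim c 0) hc⟩
  · refine isUnit_det_of_right_inverse (B := -!![4, 5, 7, 10, 8, 6, 4, 2;
      5, 8, 10, 15, 12, 9, 6, 3;
      7, 10, 14, 20, 16, 12, 8, 4;
      10, 15, 20, 30, 24, 18, 12, 6;
      8, 12, 16, 24, 20, 15, 10, 5;
      6, 9, 12, 18, 15, 12, 8, 4;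
      4, 6, 8, 12, 10, 8, 6, 3;
      2, 3, 4, 6, 5, 4, 3, 2]) ?_
    decide
  · by_contra! h
    have key : x ⬝ᵥ E8N.map (Int.castRingHom ℚ) *ᵥ x = -(2 * (x 0 - x 2 / 2) ^ 2 +
        2 * (x 1 - x 3 / 2) ^ 2 + 3 / 2 * (x 2 - 2 / 3 * x 3) ^ 2 + 2 * (x 7 - x 6 / 2) ^ 2 +
        3 / 2 * (x 6 - 2 / 3 * x 5) ^ 2 + 4 / 3 * (x 5 - 3 / 4 * x 4) ^ 2 +
        5 / 4 * (x 4 - 4 / 5 * x 3) ^ 2 + 1 / 30 * x 3 ^ 2) := by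
      simp [E8N, dotProduct, mulVec, Fin.sum_univ_eight]
      ring
    rw [key] at h
    have h3 : x 3 = 0 := by
      refine pow_eq_zero_iff two_ne_zero |>.1 (le_antisymm ?_ (sq_nonneg _))
      nlinarith [sq_nonneg (x 0 - x 2 / 2), sq_nonneg (x 1 - x 3 / 2),
        sq_nonneg (x 2 - 2 / 3 * x 3),
        sq_nonneg (x 7 - x 6 / 2), sq_nonneg (x 6 - 2 / 3 * x 5), sq_nonneg (x 5 - 3 / 4 * x 4),
        sq_nonneg (x 4 - 4 / 5 * x 3)]
    rw [h3] at h
    simp only [mul_zero, zero_div, sub_zero] at h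
    have h4 : x 4 = 0 := by
      refine pow_eq_zero_iff two_ne_zero |>.1 (le_antisymm ?_ (sq_nonneg _))
      nlinarith [sq_nonneg (x 0 - x 2 / 2), sq_nonneg (x 1), sq_nonneg (x 2),
        sq_nonneg (x 7 - x 6 / 2), sq_nonneg (x 6 - 2 / 3 * x 5), sq_nonneg (x 5 - 3 / 4 * x 4)]
    have h1 : x 1 = 0 := by
      refine pow_eq_zero_iff two_ne_zero |>.1 (le_antisymm ?_ (sq_nonneg _))
      nlinarith [sq_nonneg (x 0 - x 2 / 2), sq_nonneg (x 4), sq_nonneg (x 2),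
        sq_nonneg (x 7 - x 6 / 2), sq_nonneg (x 6 - 2 / 3 * x 5), sq_nonneg (x 5 - 3 / 4 * x 4)]
    have h2 : x 2 = 0 := by
      refine pow_eq_zero_iff two_ne_zero |>.1 (le_antisymm ?_ (sq_nonneg _))
      nlinarith [sq_nonneg (x 0 - x 2 / 2), sq_nonneg (x 1), sq_nonneg (x 4),
        sq_nonneg (x 7 - x 6 / 2), sq_nonneg (x 6 - 2 / 3 * x 5), sq_nonneg (x 5 - 3 / 4 * x 4)]
    rw [h1, h2, h4] at h
    simp only [mul_zero, zero_div, sub_zero] at h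
    have h5 : x 5 = 0 := by
      refine pow_eq_zero_iff two_ne_zero |>.1 (le_antisymm ?_ (sq_nonneg _))
      nlinarith [sq_nonneg (x 0), sq_nonneg (x 7 - x 6 / 2), sq_nonneg (x 6 - 2 / 3 * x 5)]
    have h0 : x 0 = 0 := by
      refine pow_eq_zero_iff two_ne_zero |>.1 (le_antisymm ?_ (sq_nonneg _))
      nlinarith [sq_nonneg (x 5), sq_nonneg (x 7 - x 6 / 2), sq_nonneg (x 6 - 2 / 3 * x 5)]
    rw [h5] at h
    simp only [mul_zero, sub_zero] at h
    have h6 : x 6 = 0 := by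
      refine pow_eq_zero_iff two_ne_zero |>.1 (le_antisymm ?_ (sq_nonneg _))
      nlinarith [sq_nonneg (x 0), sq_nonneg (x 7 - x 6 / 2)]
    have h7 : x 7 = 0 := by
      rw [h6] at h
      refine pow_eq_zero_iff two_ne_zero |>.1 (le_antisymm ?_ (sq_nonneg _))
      nlinarith [sq_nonneg (x 0)]
    exact hx0 (by
      ext i
      fin_cases i <;> assumption)

end UnimodularEven

section Embeddings

theorem latForm_cast {ι : Type} [Fintype ι] (B : Matrix ι ι ℤ) (x y : ι → ℤ) :
    ((latForm B x y : ℤ) : ℚ) =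
      (fun i => (x i : ℚ)) ⬝ᵥ B.map (Int.castRingHom ℚ) *ᵥ fun i => (y i : ℚ) := by
  simp [latForm, dotProduct, mulVec]

theorem cast_mulVec {ι κ : Type*} [Fintype κ] (M : Matrix ι κ ℤ) (x : κ → ℤ) :
    (fun i => ((M *ᵥ x) i : ℚ)) = M.map (Int.castRingHom ℚ) *ᵥ fun i => (x i : ℚ) := by
  ext i
  simp [mulVec, dotProduct]

theorem IsNegDefLattice.rat_neg {ι : Type} [Fintype ι] {B : Matrix ι ι ℤ}
    (hB : IsNegDefLattice B) {v : ι → ℚ} (hv : v ≠ 0) :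
    v ⬝ᵥ B.map (Int.castRingHom ℚ) *ᵥ v < 0 := by
  obtain ⟨c, hc, h⟩ := (Matrix.of fun i (_ : Fin 1) => v i).exists_natCast_mul_eq_intCast
  choose u hu using fun i => h i 0
  have hc' : (c : ℚ) ≠ 0 := by exact_mod_cast hc
  have hcv : (fun i => (u i : ℚ)) = (c : ℚ) • v := funext hu
  have hu0 : u ≠ 0 := by
    rintro rfl
    have : (c : ℚ) • v = 0 := hcv ▸ (by ext; simp)
    exact hv ((smul_eq_zero.1 this).resolve_left hc')
  have h1 : ((latForm B u u : ℤ) : ℚ) < 0 := by exact_mod_cast hB u hu0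
  rw [latForm_cast, hcv, mulVec_smul, dotProduct_smul, smul_dotProduct, smul_eq_mul, smul_eq_mul,
    ← mul_assoc] at h1
  exact (pos_iff_neg_of_mul_neg h1).1 (mul_self_pos.2 hc')

theorem isNegDefLattice_of_rat_neg {ι : Type} [Fintype ι] {B : Matrix ι ι ℤ}
    (h : ∀ v : ι → ℚ, v ≠ 0 → v ⬝ᵥ B.map (Int.castRingHom ℚ) *ᵥ v < 0) : IsNegDefLattice B := by
  intro x hx
  have := h (fun i => (x i : ℚ)) fun h0 => hx (by
    ext i
    simpa using congrFun h0 i)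
  rw [← latForm_cast] at this
  exact_mod_cast this

theorem IsPrimitiveEmbedding.comp {ι κ μ : Type} [Fintype ι] [Fintype κ] [Fintype μ]
    {A : Matrix ι ι ℤ} {B : Matrix κ κ ℤ} {C : Matrix μ μ ℤ} {g : (κ → ℤ) →ₗ[ℤ] (μ → ℤ)}
    {f : (ι → ℤ) →ₗ[ℤ] (κ → ℤ)} (hg : IsPrimitiveEmbedding B C g)
    (hf : IsPrimitiveEmbedding A B f) : IsPrimitiveEmbedding A C (g ∘ₗ f) := by
  refine ⟨hg.1.comp hf.1, fun x y => (hg.2.1 _ _).trans (hf.2.1 x y), ?_⟩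
  rintro x c hc ⟨s, hs⟩
  obtain ⟨y, rfl⟩ := hg.2.2 x c hc ⟨f s, hs⟩
  have h1 : f s = c • y := hg.1 (by rw [map_smul]; exact hs)
  obtain ⟨t, rfl⟩ := hf.2.2 y c hc ⟨s, h1⟩
  exact ⟨t, rfl⟩

theorem IsPrimitiveEmbedding.fromBlocks_right {ι κ μ : Type} [Fintype ι] [Fintype κ] [Fintype μ]
    (A : Matrix ι ι ℤ) {B : Matrix κ κ ℤ} {C : Matrix μ μ ℤ} {f : (κ → ℤ) →ₗ[ℤ] (μ → ℤ)}
    (hf : IsPrimitiveEmbedding B C f) :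
    IsPrimitiveEmbedding (fromBlocks A 0 0 B) (fromBlocks A 0 0 C)
      ((LinearEquiv.sumArrowLequivProdArrow ι μ ℤ ℤ).symm ∘ₗ (LinearMap.id.prodMap f) ∘ₗ
        (LinearEquiv.sumArrowLequivProdArrow ι κ ℤ ℤ).toLinearMap) := by
  refine ⟨?_, fun x y => ?_, ?_⟩
  · intro x y hxy
    have h1 : f (x ∘ Sum.inr) = f (y ∘ Sum.inr) := funext fun i => congrFun hxy (Sum.inr i)
    ext i
    rcases i with i | i
    · exact congrFun hxy (Sum.inl i)
    · exact congrFun (hf.1 h1) i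
  · simp only [latForm, dotProduct_fromBlocks_mulVec]
    exact congrArg₂ _ rfl (hf.2.1 _ _)
  · rintro x c hc ⟨s, hs⟩
    have h1 : ∀ i, s (Sum.inl i) = c * x (Sum.inl i) := fun i => congrFun hs (Sum.inl i)
    have h2 : f (s ∘ Sum.inr) = c • (x ∘ Sum.inr) := by
      ext i
      exact congrFun hs (Sum.inr i)
    obtain ⟨t, ht⟩ := hf.2.2 _ c hc ⟨_, h2⟩
    refine ⟨Sum.elim (x ∘ Sum.inl) t, ?_⟩
    ext i
    rcases i with i | i
    · rfl
    · exact congrFun ht i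

theorem isPrimitiveEmbedding_minusTwo_UMat :
    IsPrimitiveEmbedding minusTwo UMat (!![1; -1] : Matrix (Fin 2) (Fin 1) ℤ).mulVecLin := by
  have h0 : ∀ s : Fin 1 → ℤ, (!![1; -1] : Matrix (Fin 2) (Fin 1) ℤ).mulVecLin s 0 = s 0 := by
    intro s
    simp [mulVec, dotProduct]
  have h1 : ∀ s : Fin 1 → ℤ, (!![1; -1] : Matrix (Fin 2) (Fin 1) ℤ).mulVecLin s 1 = -s 0 := by
    intro s
    simp [mulVec, dotProduct]
  refine ⟨fun x y hxy => ?_, fun x y => ?_, ?_⟩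
  · ext i
    rw [Subsingleton.elim i 0, ← h0 x, ← h0 y, hxy]
  · simp only [latForm, dotProduct, mulVec, Fin.sum_univ_two, h0, h1]
    simp [UMat, minusTwo]
    ring
  · rintro x c hc ⟨s, hs⟩
    have h2 : s 0 = c * x 0 := (h0 s).symm.trans (congrFun hs 0)
    have h3 : -s 0 = c * x 1 := (h1 s).symm.trans (congrFun hs 1)
    refine ⟨fun _ => x 0, ?_⟩
    ext i
    fin_cases i
    · exact h0 _
    · refine (h1 _).trans (mul_left_cancel₀ hc (?_ : c * -x 0 = c * x 1))
      rw [← h3, h2]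
      ring

theorem IsPrimitiveEmbedding.exists_reindex {ι κ κ' : Type} [Fintype ι] [Fintype κ]
    [DecidableEq κ] [Fintype κ'] [DecidableEq κ'] (e : κ' ≃ κ) {A : Matrix ι ι ℤ}
    {B : Matrix κ κ ℤ} {f : (ι → ℤ) →ₗ[ℤ] (κ → ℤ)} (hf : IsPrimitiveEmbedding A B f) :
    IsPrimitiveEmbedding A (B.submatrix e e) (LinearMap.funLeft ℤ ℤ e ∘ₗ f) := by
  have hlat : ∀ x y, latForm (B.submatrix e e) (x ∘ e) (y ∘ e) = latForm B x y := by
    intro x y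
    rw [latForm, submatrix_mulVec_equiv, Function.comp_assoc, e.self_comp_symm, Function.comp_id,
      comp_equiv_dotProduct_comp_equiv, latForm]
  refine ⟨(LinearMap.funLeft_injective_of_surjective ℤ ℤ e e.surjective).comp hf.1,
    fun x y => (hlat _ _).trans (hf.2.1 x y), ?_⟩
  rintro x c hc ⟨s, hs⟩
  obtain ⟨t, ht⟩ := hf.2.2 (x ∘ e.symm) c hc ⟨s, by
    ext i
    simpa using congrFun hs (e.symm i)⟩
  refine ⟨t, ?_⟩
  ext i
  simpa using congrFun ht (e i)

end Embeddings

section Assembly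

variable {ι κ : Type*} [Fintype ι] [Fintype κ] [DecidableEq κ]

theorem dotProduct_twistedForm_mulVec {G : Matrix ι ι ℚ} {w : Matrix ι κ ℚ} {a : κ → ℚ}
    (ha : ∀ i, a i ≠ 0) (c : ℚ) (x y : ι → ℚ) :
    x ⬝ᵥ twistedForm G w a c *ᵥ y = x ⬝ᵥ G *ᵥ y +
      (c - 1) * ∑ i, ((wᵀ * G) *ᵥ x) i * ((wᵀ * G) *ᵥ y) i / a i := by
  rw [twistedForm, add_mulVec, dotProduct_add, smul_mulVec, dotProduct_smul, smul_eq_mul,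
    ← mulVec_mulVec, dotProduct_mulVec _ (_ᵀ), vecMul_transpose]
  congr 2
  refine Finset.sum_congr rfl fun i _ => ?_
  simp only [← mulVec_mulVec, mulVec_diagonal]
  have := ha i
  field_simp

theorem twistedForm_neg {G : Matrix ι ι ℚ} (hG : Gᵀ = G) {w : Matrix ι κ ℚ} {a : κ → ℚ}
    (ha : ∀ i, 0 < a i) (hw : wᵀ * G * w = diagonal a) {c : ℚ} (hc : c < 0)
    (hneg : ∀ y, (wᵀ * G) *ᵥ y = 0 → y ≠ 0 → y ⬝ᵥ G *ᵥ y < 0) {x : ι → ℚ} (hx : x ≠ 0) :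
    x ⬝ᵥ twistedForm G w a c *ᵥ x < 0 := by
  rw [dotProduct_twistedForm_mulVec fun i => (ha i).ne']
  set u := (wᵀ * G) *ᵥ x with hu
  set v : κ → ℚ := fun i => u i / a i with hv
  set y := x - w *ᵥ v with hy
  have hDv : diagonal a *ᵥ v = u := by
    ext i
    rw [mulVec_diagonal, hv]
    have := (ha i).ne'
    field_simp
  have hwy : (wᵀ * G) *ᵥ y = 0 := by
    rw [hy, mulVec_sub, mulVec_mulVec, hw, hDv, sub_self]
  have hxy : x = y + w *ᵥ v := by rw [hy, sub_add_cancel]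
  have h1 : y ⬝ᵥ G *ᵥ (w *ᵥ v) = 0 := by
    rw [mulVec_mulVec, dotProduct_mulVec, ← mulVec_transpose, transpose_mul, hG, hwy,
      zero_dotProduct]
  have h2 : (w *ᵥ v) ⬝ᵥ G *ᵥ x = ∑ i, u i * u i / a i := by
    rw [← vecMul_transpose, ← dotProduct_mulVec, mulVec_mulVec, ← hu]
    refine Finset.sum_congr rfl fun i _ => ?_
    rw [hv]
    ring
  have h3 : x ⬝ᵥ G *ᵥ x = y ⬝ᵥ G *ᵥ y + ∑ i, u i * u i / a i := by
    rw [← h2]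
    conv_lhs => enter [1]; rw [hxy]
    rw [add_dotProduct]
    congr 1
    rw [hxy, mulVec_add, dotProduct_add, h1, add_zero]
  rw [h3, add_assoc, ← one_add_mul, add_sub_cancel]
  have hsum : ∀ i, 0 ≤ u i * u i / a i := fun i => div_nonneg (mul_self_nonneg _) (ha i).le
  by_cases hy0 : y = 0
  · have hu0 : u ≠ 0 := fun hu0 => hx (by
      rw [hxy, hy0, hv, hu0]
      simp only [Pi.zero_apply, zero_div, zero_add]
      exact mulVec_zero w)
    obtain ⟨i, hi⟩ := Function.ne_iff.1 hu0
    rw [hy0, zero_dotProduct, zero_add]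
    exact mul_neg_of_neg_of_pos hc (Finset.sum_pos' (fun i _ => hsum i)
      ⟨i, Finset.mem_univ i, div_pos (mul_self_pos.2 hi) (ha i)⟩)
  · exact add_neg_of_neg_of_nonpos (hneg y hwy hy0)
      (mul_nonpos_of_nonpos_of_nonneg hc.le (Finset.sum_nonneg fun i _ => hsum i))

end Assembly

section Neighbor

variable {ι : Type} [Fintype ι] [DecidableEq ι]

/-- A negative definite sublattice of an even unimodular lattice of positive index `4` is
orthogonal to four pairwise orthogonal integral vectors of positive square. -/
theorem exists_orthogonal_positive_int {κ : Type*} [Fintype κ] (hκ : Fintype.card κ = 4)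
    {G : Matrix ι ι ℤ} (hG : IsEvenUnimodularOfIndex G κ) {k : ℕ} {BS : Matrix (Fin k) (Fin k) ℤ}
    (hdet : BS.det ≠ 0) (hneg : IsNegDefLattice BS) {Φ : Matrix ι (Fin k) ℤ}
    (hΦ : Φᵀ * G * Φ = BS) :
    ∃ (w : Matrix ι (Fin 4) ℤ) (a : Fin 4 → ℤ), (∀ i, 0 < a i) ∧ wᵀ * G * w = diagonal a ∧
      wᵀ * G * Φ = 0 ∧
      ∀ y, ((w.map (Int.castRingHom ℚ))ᵀ * G.map (Int.castRingHom ℚ)) *ᵥ y = 0 → y ≠ 0 →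
        y ⬝ᵥ G.map (Int.castRingHom ℚ) *ᵥ y < 0 := by
  obtain ⟨⟨T, hT⟩, -, ⟨l, hl⟩, P, hP⟩ := hG
  set Gq := G.map (Int.castRingHom ℚ) with hGq
  set Φq := Φ.map (Int.castRingHom ℚ) with hΦq
  set Bq := BS.map (Int.castRingHom ℚ) with hBq
  have hGsymm : Gqᵀ = Gq := by
    rw [hGq, ← transpose_map, hT, transpose_add, transpose_transpose, add_comm]
  have hΦB : Φqᵀ * Gq * Φq = Bq := by
    rw [hΦq, hGq, hBq, ← transpose_map, ← Matrix.map_mul, ← Matrix.map_mul, hΦ]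
  have hBdet : IsUnit Bq.det := by
    rw [hBq, ← RingHom.mapMatrix_apply, ← RingHom.map_det, isUnit_iff_ne_zero]
    exact Int.cast_ne_zero.2 hdet
  set B := Matrix.toBilin' Gq with hB
  have hBapp : ∀ x y, B x y = x ⬝ᵥ Gq *ᵥ y := fun x y => toBilin'_apply' _ _ _
  have hBsymm : B.IsSymm := ⟨fun x y => by
    rw [hBapp, hBapp, dotProduct_mulVec, ← mulVec_transpose, hGsymm,
      dotProduct_comm]⟩
  obtain ⟨W, horth, hpos, hWF⟩ := LinearMap.BilinForm.exists_orthogonal_positive hBsymm P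
    (fun c hc => by rw [hBapp]; exact hP c hc) (F := LinearMap.range Φq.mulVecLin)
    (by
      rintro _ ⟨v, rfl⟩
      rw [hBapp, mulVecLin_apply, mulVec_mulVec, ← vecMul_transpose, ← dotProduct_mulVec,
        mulVec_mulVec, ← Matrix.mul_assoc, hΦB]
      by_cases hv : v = 0
      · rw [hv, zero_dotProduct]
      · exact (hneg.rat_neg hv).le)
    (fun x => ⟨_, ⟨Bq⁻¹ *ᵥ ((Φqᵀ * Gq) *ᵥ x), rfl⟩, by
      rintro _ ⟨v, rfl⟩
      rw [hBsymm.eq, hBapp, mulVecLin_apply, mulVecLin_apply, ← vecMul_transpose,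
        ← dotProduct_mulVec, mulVec_mulVec, mulVec_sub, mulVec_mulVec, mulVec_mulVec, hΦB,
        mul_nonsing_inv _ hBdet, one_mulVec, sub_self, dotProduct_zero]⟩) 4 hκ.ge
  obtain ⟨c, hc, h⟩ := (Matrix.of fun i j => W j i).exists_natCast_mul_eq_intCast
  choose w hw using h
  have hc' : (c : ℚ) ≠ 0 := by exact_mod_cast hc
  have hwW : ∀ j, (fun i => (w i j : ℚ)) = (c : ℚ) • W j := fun j => funext fun i => hw i j
  have hwB : ∀ i j, ((((Matrix.of w)ᵀ * G * Matrix.of w) i j : ℤ) : ℚ) =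
      c * c * B (W i) (W j) := by
    intro i j
    have h1 : ((Matrix.of w)ᵀ * G * Matrix.of w) i j =
        latForm G (fun k => w k i) (fun k => w k j) := by
      rw [latForm, Matrix.mul_assoc]
      rfl
    rw [h1, latForm_cast, hwW, hwW, ← hBapp, map_smul, map_smul, LinearMap.smul_apply, smul_eq_mul,
      smul_eq_mul, mul_assoc]
  have hcc : (0 : ℚ) < c * c := mul_self_pos.2 hc'
  have hdiag : (Matrix.of w)ᵀ * G * Matrix.of w =
      diagonal fun i => ((Matrix.of w)ᵀ * G * Matrix.of w) i i := by
    ext i j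
    by_cases hij : i = j
    · rw [hij, diagonal_apply_eq]
    · have := hwB i j
      rw [horth i j hij, mul_zero] at this
      rw [diagonal_apply_ne _ hij]
      exact_mod_cast this
  refine ⟨Matrix.of w, _, fun i => ?_, hdiag, ?_, fun y hy hy0 => ?_⟩
  · have := mul_pos hcc (hpos i)
    rw [← hwB] at this
    exact_mod_cast this
  · ext i j
    have h1 : ((Matrix.of w)ᵀ * G * Φ) i j = latForm G (fun k => w k i) (fun k => Φ k j) := by
      rw [latForm, Matrix.mul_assoc]
      rfl
    have h2 : (fun k => (Φ k j : ℚ)) ∈ LinearMap.range Φq.mulVecLin :=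
      ⟨Pi.single j 1, by ext; simp [hΦq]⟩
    have h3 : ((latForm G (fun k => w k i) (fun k => Φ k j) : ℤ) : ℚ) = 0 := by
      rw [latForm_cast, hwW, ← hBapp, map_smul, LinearMap.smul_apply, hWF i _ h2, smul_zero]
    rw [h1]
    exact_mod_cast h3
  · rw [← hBapp]
    refine LinearMap.BilinForm.neg_of_orthogonal_positive hBsymm (by simpa using hκ) l
      (fun x h1 h2 => by rw [hBapp]; exact hl x h1 h2) horth hpos (fun i => ?_) hy0
    have h1 : (fun k => (w k i : ℚ)) ⬝ᵥ Gq *ᵥ y = 0 := by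
      rw [← mulVec_mulVec] at hy
      exact congrFun hy i
    rw [hwW, ← hBapp, map_smul, LinearMap.smul_apply, smul_eq_mul] at h1
    exact (mul_eq_zero.1 h1).resolve_left hc'

/-- A primitive negative definite sublattice of an even unimodular lattice of positive index `4`
embeds primitively in a negative definite even unimodular lattice of the same rank. -/
theorem exists_negDef_unimodular {κ : Type*} [Fintype κ] (hκ : Fintype.card κ = 4)
    {G : Matrix ι ι ℤ} (hG : IsEvenUnimodularOfIndex G κ) {k : ℕ} {BS : Matrix (Fin k) (Fin k) ℤ}
    (hdet : BS.det ≠ 0) (hneg : IsNegDefLattice BS) {f : (Fin k → ℤ) →ₗ[ℤ] (ι → ℤ)}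
    (hf : IsPrimitiveEmbedding BS G f) :
    ∃ C : Matrix ι ι ℤ, IsEvenLattice C ∧ IsNegDefLattice C ∧ IsUnit C.det ∧
      ∃ g : (Fin k → ℤ) →ₗ[ℤ] (ι → ℤ), IsPrimitiveEmbedding BS C g := by
  set Φ := LinearMap.toMatrix' f with hΦdef
  have hfΦ : ∀ s, f s = Φ *ᵥ s := fun s => (LinearMap.toMatrix'_mulVec f s).symm
  have hΦ : Φᵀ * G * Φ = BS := by
    ext i j
    have := hf.2.1 (Pi.single i 1) (Pi.single j 1)
    simp only [latForm, hfΦ] at this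
    rw [← vecMul_transpose, ← dotProduct_mulVec, mulVec_mulVec, mulVec_mulVec] at this
    simpa using this
  obtain ⟨w, a, ha, hw, hwΦ, hWneg⟩ := exists_orthogonal_positive_int hκ hG hdet hneg hΦ
  obtain ⟨T, hT⟩ := hG.exists_eq_add_transpose
  obtain ⟨b, C, hb, hC, hsymm, heven, hCdet, hx⟩ :=
    exists_twisted_lattice hT hG.isUnit_det (fun i => (ha i).ne') hw
  set Gq := G.map (Int.castRingHom ℚ) with hGq
  set wq := w.map (Int.castRingHom ℚ) with hwq
  have haq : ∀ i, (0 : ℚ) < a i := fun i => by exact_mod_cast ha i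
  set c : ℚ := -(a 0 * a 3 / (a 1 * a 2)) with hc
  have hc0 : c < 0 :=
    neg_neg_of_pos (div_pos (mul_pos (haq 0) (haq 3)) (mul_pos (haq 1) (haq 2)))
  have hGsymm : Gqᵀ = Gq := by
    rw [hGq, ← transpose_map, hT, transpose_add, transpose_transpose, add_comm]
  have hww : wqᵀ * Gq * wq = diagonal fun i => (a i : ℚ) := by
    rw [hwq, hGq, ← transpose_map, ← Matrix.map_mul, ← Matrix.map_mul, hw,
      diagonal_map (map_zero _)]
    rfl
  have hwΦq : wqᵀ * Gq * Φ.map (Int.castRingHom ℚ) = 0 := by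
    rw [hwq, hGq, ← transpose_map, ← Matrix.map_mul, ← Matrix.map_mul, hwΦ]
    exact Matrix.map_zero _ (map_zero _)
  have hbinj : Function.Injective b.mulVec := mulVec_injective_of_isUnit
    ((isUnit_iff_isUnit_det b).2 hb)
  have hCapp : ∀ x y : ι → ℚ, x ⬝ᵥ C.map (Int.castRingHom ℚ) *ᵥ y = (b *ᵥ x) ⬝ᵥ
      twistedForm Gq wq (fun i => (a i : ℚ)) c *ᵥ (b *ᵥ y) := by
    intro x y
    rw [hC, ← mulVec_mulVec, ← mulVec_mulVec, dotProduct_mulVec, vecMul_transpose]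
  have hfs : ∀ s, (wqᵀ * Gq) *ᵥ (fun i => ((f s) i : ℚ)) = 0 := by
    intro s
    rw [hfΦ, cast_mulVec, mulVec_mulVec, hwΦq, zero_mulVec]
  have hcol : ∀ j, ∃ z : ι → ℤ, (fun i => (f (Pi.single j 1) i : ℚ)) =
      b *ᵥ fun i => (z i : ℚ) := fun j => (hx _ (hfs _)).1 fun i => ⟨_, rfl⟩
  choose z hz using hcol
  set Z : Matrix ι (Fin k) ℤ := Matrix.of fun i j => z j i with hZ
  have hbZ : b * Z.map (Int.castRingHom ℚ) = Φ.map (Int.castRingHom ℚ) := by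
    ext i j
    have := congrFun (hz j) i
    simp only [hfΦ, mulVec_single_one] at this
    exact this.symm
  have hbg : ∀ s, b *ᵥ (fun i => ((Z *ᵥ s) i : ℚ)) = fun i => ((f s) i : ℚ) := by
    intro s
    rw [cast_mulVec, mulVec_mulVec, hbZ, hfΦ, cast_mulVec]
  refine ⟨C, ⟨hsymm, hCdet.ne_zero, heven⟩, isNegDefLattice_of_rat_neg fun v hv => ?_, hCdet,
    Z.mulVecLin, fun s t hst => hf.1 ?_, fun s t => ?_, ?_⟩
  · rw [hCapp]
    exact twistedForm_neg hGsymm haq hww hc0 hWneg fun h0 => hv (hbinj (by rw [h0, mulVec_zero]))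
  · have h1 : (fun i => (f s i : ℚ)) = fun i => (f t i : ℚ) := by
      rw [← hbg, ← hbg]
      simp only [mulVecLin_apply] at hst
      rw [hst]
    ext i
    exact_mod_cast congrFun h1 i
  · have h1 : ((latForm C (Z *ᵥ s) (Z *ᵥ t) : ℤ) : ℚ) = ((latForm G (f s) (f t) : ℤ) : ℚ) := by
      rw [latForm_cast, hCapp, hbg, hbg, dotProduct_twistedForm_mulVec fun i => (haq i).ne',
        latForm_cast, hfs]
      simp [hGq]
    rw [← hf.2.1]
    exact_mod_cast h1
  · rintro x m hm ⟨s, hs⟩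
    have hm' : (m : ℚ) ≠ 0 := by exact_mod_cast hm
    have h1 : (fun i => ((f s) i : ℚ)) = (m : ℚ) • (b *ᵥ fun i => (x i : ℚ)) := by
      rw [← hbg, ← mulVec_smul]
      congr 1
      ext i
      have := congrFun hs i
      simp only [mulVecLin_apply, Pi.smul_apply, smul_eq_mul] at this ⊢
      exact_mod_cast this
    have h2 : (wqᵀ * Gq) *ᵥ (b *ᵥ fun i => (x i : ℚ)) = 0 := by
      have := hfs s
      rw [h1, mulVec_smul] at this
      exact (smul_eq_zero.1 this).resolve_left hm'
    have h3 := (hx _ h2).2 ⟨x, rfl⟩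
    choose y hy using h3
    obtain ⟨t, ht⟩ := hf.2.2 y m hm ⟨s, by
      ext i
      have := congrFun h1 i
      simp only [Pi.smul_apply, smul_eq_mul, ← hy] at this ⊢
      exact_mod_cast this⟩
    refine ⟨t, ?_⟩
    have h4 : (fun i => ((Z *ᵥ t) i : ℚ)) = fun i => (x i : ℚ) := hbinj (by
      rw [hbg, ht]
      exact funext hy)
    ext i
    exact_mod_cast congrFun h4 i

end Neighbor

/-- If an even negative definite lattice `S` admits a primitive embedding into
`U³ ⊕ E8(-1)² ⊕ (-2)`, then it admits a primitive embedding into some Niemeier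
lattice, i.e. an even negative definite unimodular lattice of rank 24. -/
theorem embeds_in_niemeier {k : ℕ} (BS : Matrix (Fin k) (Fin k) ℤ)
    (hBS : IsEvenLattice BS) (hneg : IsNegDefLattice BS)
    (hemb : ∃ f : (Fin k → ℤ) →ₗ[ℤ] (IdxL → ℤ), IsPrimitiveEmbedding BS BL f) :
    ∃ BN : Matrix (Fin 24) (Fin 24) ℤ,
      IsEvenLattice BN ∧ IsNegDefLattice BN ∧ IsUnit BN.det ∧
      ∃ g : (Fin k → ℤ) →ₗ[ℤ] (Fin 24 → ℤ), IsPrimitiveEmbedding BS BN g := by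
  obtain ⟨f, hf⟩ := hemb
  have hL := isPrimitiveEmbedding_minusTwo_UMat.fromBlocks_right E8N |>.fromBlocks_right E8N
    |>.fromBlocks_right UMat |>.fromBlocks_right UMat |>.fromBlocks_right UMat
  have hU := isEvenUnimodularOfIndex_UMat
  have hE := isEvenUnimodularOfIndex_E8N
  obtain ⟨C, hC, hCneg, hCdet, g, hg⟩ := exists_negDef_unimodular (by simp)
    (hU.fromBlocks (hU.fromBlocks (hU.fromBlocks (hE.fromBlocks (hE.fromBlocks hU)))))
    hBS.2.1 hneg (hL.comp hf)
  have e := Fintype.equivOfCardEq (α := Fin 24)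
    (β := Fin 2 ⊕ (Fin 2 ⊕ (Fin 2 ⊕ (Fin 8 ⊕ (Fin 8 ⊕ Fin 2))))) (by simp)
  refine ⟨C.submatrix e e, ⟨?_, ?_, fun i => hC.2.2 _⟩, fun x hx => ?_, ?_, _,
    hg.exists_reindex e⟩
  · exact hC.1.submatrix e
  · rw [det_submatrix_equiv_self]
    exact hC.2.1
  · rw [latForm, submatrix_mulVec_equiv, ← comp_equiv_symm_dotProduct]
    refine hCneg (x ∘ e.symm) fun h0 => hx ?_
    ext i
    simpa using congrFun h0 (e i)
  · rwa [det_submatrix_equiv_self]
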